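/- arXiv:2311.03230 — 5 statements merged into one kernel-verified Lean document; each statement's English description precedes it below -/
import Mathlib

section
/- There exists an absolute constant C such that the following holds for every d ≥ 2, every real α > 4, and every MLIJ instance on d machines (with arbitrary processing times p_1,…,p_d > 0 and number of jobs n ≥ 1) with feasible set D: there exists a subset X ⊆ D with |X| ≤ C·(1 + log d / log(α/4)) such that (i) X is an α-approximate portfolio for the class of all ordered norms over D, and (ii) X is a (C·α·log d)-approximate portfolio for the class of all symmetric monotonic norms over D. -/
/-- The vector of absolute values of the coordinates of `x`, sorted in decreasing order. -/
noncomputable def absSortDesc {d : ℕ} (x : Fin d → ℝ) : Fin d → ℝ :=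
  fun k => |x (Tuple.sort (fun i => |x i|) k.rev)|

/-- The ordered norm `‖x‖_(w) = Σ_k w_k (|x|↓)_k`. -/
noncomputable def orderedNorm {d : ℕ} (w x : Fin d → ℝ) : ℝ :=
  ∑ k, w k * absSortDesc x k

/-- The top-`k` norm: the sum of the `k` largest coordinates of `|x|`. -/
noncomputable def topkNorm {d : ℕ} (k : ℕ) (x : Fin d → ℝ) : ℝ :=
  ∑ i ∈ Finset.univ.filter (fun i : Fin d => (i : ℕ) < k), absSortDesc x i

/-- A weight vector: nonincreasing, nonnegative, nonzero. -/
def IsWeightVector {d : ℕ} (w : Fin d → ℝ) : Prop :=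
  Antitone w ∧ (∀ k, 0 ≤ w k) ∧ w ≠ 0

/-- A symmetric monotonic norm on `ι → ℝ`. -/
def IsSymMonotoneNorm {ι : Type*} [Fintype ι] (f : (ι → ℝ) → ℝ) : Prop :=
  (∀ x, f x = 0 ↔ x = 0) ∧
  (∀ (a : ℝ) (x : ι → ℝ), f (a • x) = |a| * f x) ∧
  (∀ x y : ι → ℝ, f (x + y) ≤ f x + f y) ∧
  (∀ (σ : Equiv.Perm ι) (x : ι → ℝ), f (x ∘ σ) = f x) ∧
  (∀ x y : ι → ℝ, (∀ i, 0 ≤ x i) → (∀ i, x i ≤ y i) → f x ≤ f y)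

/-- Feasible load vectors of the Machine-Loads-Identical-Jobs problem. -/
def MLIJ {d : ℕ} (p : Fin d → ℝ) (n : ℕ) : Set (Fin d → ℝ) :=
  { x | ∃ m : Fin d → ℕ, (∑ i, m i) = n ∧ ∀ i, x i = (m i : ℝ) * p i }

/-- The dual of the ordered norm. -/
noncomputable def dualOrderedNorm {d : ℕ} (w y : Fin d → ℝ) : ℝ :=
  sSup { r : ℝ | ∃ x : Fin d → ℝ, orderedNorm w x ≤ 1 ∧ r = ∑ i, y i * x i }

/-- The coordinates of `x` sorted in increasing order. -/
noncomputable def sortAsc {n : ℕ} (x : Fin n → ℝ) : Fin n → ℝ :=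
  fun k => x (Tuple.sort x k)

/-- Distance vector induced by a set of open facilities. -/
noncomputable def distVec {X : Type*} [MetricSpace X] (F : Finset X) : X → ℝ :=
  fun j => sInf ((fun c => dist j c) '' (F : Set X))

/-- `x(l)`: the vector with the first `l+1` coordinates (indices `≤ l`) equal to
`n / Σ_{j ≤ l} 1/p_j` and zero elsewhere. -/
noncomputable def vertexX {d : ℕ} (p : Fin d → ℝ) (n : ℝ) (l : Fin d) : Fin d → ℝ :=
  fun i => if i ≤ l then n / (∑ j ∈ Finset.univ.filter (fun j : Fin d => j ≤ l), 1 / p j) else 0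

/-- Completion time of job `j` when job `j'` is assigned to machine `a j'` and jobs are
processed on each machine in the order induced by the priority permutation `π`. -/
noncomputable def completionTime {n d : ℕ} (p : Fin d → Fin n → ℝ)
    (a : Fin n → Fin d) (π : Equiv.Perm (Fin n)) : Fin n → ℝ :=
  fun j => ∑ j' ∈ Finset.univ.filter (fun j' : Fin n => a j' = a j ∧ π j' ≤ π j), p (a j) j'

/-- A tour on `n` vertices starting at `v₀`: `τ 0 = v₀` and `τ` is a bijection from
`{0, …, n-1}` onto the vertex set. -/
def IsTour {V : Type*} (n : ℕ) (v₀ : V) (τ : ℕ → V) : Prop :=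
  τ 0 = v₀ ∧ Set.BijOn τ (Set.Iio n) Set.univ

/-- The visit times of the vertices `τ 0, …, τ (n-1)` of a tour. -/
noncomputable def tourVisitTimes {V : Type*} [MetricSpace V] (n : ℕ) (τ : ℕ → V) : Fin n → ℝ :=
  fun i => ∑ j ∈ Finset.range (i : ℕ), dist (τ j) (τ (j + 1))

/-- Cover time of element `e` under the ordering `π` of the subsets `S 0, …, S (m-1)`:
the position (in `{1, …, m}`) of the first subset containing `e`. -/
noncomputable def coverTime {n m : ℕ} (S : Fin m → Finset (Fin n))
    (π : Equiv.Perm (Fin m)) (e : Fin n) : ℕ :=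
  1 + sInf {t : ℕ | ∃ h : t < m, e ∈ S (π ⟨t, h⟩)}

/-- The sum of the reciprocals of the first `l` terms of `q`. -/
noncomputable def recipSum (q : ℕ → ℝ) (l : ℕ) : ℝ := ∑ k ∈ Finset.range l, 1 / q k

/-- The indicator vector of the first `l` coordinates. -/
noncomputable def prefixIndicator (d l : ℕ) : Fin d → ℝ := fun i => if (i : ℕ) < l then 1 else 0

theorem recipSum_pos {q : ℕ → ℝ} (hq : ∀ k, 0 < q k) {l : ℕ} (hl : 1 ≤ l) : 0 < recipSum q l := by
  unfold recipSum
  exact Finset.sum_pos (fun k _ => one_div_pos.2 (hq k)) ⟨0, by simp; omega⟩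

theorem recipSum_mono {q : ℕ → ℝ} (hq : ∀ k, 0 < q k) : Monotone (recipSum q) := by
  refine monotone_nat_of_le_succ fun l => ?_
  unfold recipSum
  rw [Finset.sum_range_succ]
  have := one_div_pos.2 (hq l)
  linarith

theorem natCast_le_mul_recipSum {q : ℕ → ℝ} (hq : ∀ k, 0 < q k) (hmono : Monotone q) (l : ℕ) :
    ((l : ℝ) + 1) ≤ q l * recipSum q (l + 1) := by
  unfold recipSum
  rw [Finset.mul_sum]
  have : ∑ k ∈ Finset.range (l + 1), (1 : ℝ) ≤ ∑ k ∈ Finset.range (l + 1), q l * (1 / q k) := by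
    refine Finset.sum_le_sum fun k hk => ?_
    rw [mul_one_div, le_div_iff₀ (hq k), one_mul]
    exact hmono (by simp at hk; omega)
  simpa using this

/-- Abel summation: an antitone nonnegative sequence preserves nonnegativity of partial sums. -/
theorem sum_mul_nonneg_of_partial_sums_nonneg {a z : ℕ → ℝ} (hz : Antitone z) (L : ℕ)
    (ha : ∀ l ≤ L, 0 ≤ ∑ k ∈ Finset.range l, a k) :
    z L * ∑ k ∈ Finset.range L, a k ≤ ∑ k ∈ Finset.range L, a k * z k := by
  induction L with
  | zero => simp
  | succ L ih =>
    have h1 := ih fun l hl => ha l (by omega)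
    have h2 := ha (L + 1) le_rfl
    have h3 := mul_le_mul_of_nonneg_right (hz (Nat.le_succ L)) h2
    rw [Finset.sum_range_succ] at h3 ⊢
    rw [Finset.sum_range_succ]
    nlinarith

theorem exists_le_sum_eq {ι : Type*} [DecidableEq ι] (s : Finset ι) (c : ι → ℕ) :
    ∀ n ≤ ∑ i ∈ s, c i, ∃ m : ι → ℕ, (∀ i, m i ≤ c i) ∧ ∑ i ∈ s, m i = n := by
  induction s using Finset.induction_on with
  | empty => intro n hn; exact ⟨fun _ => 0, by simp, by simp at hn ⊢; omega⟩
  | insert a s has ih =>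
    intro n hn
    rw [Finset.sum_insert has] at hn
    obtain ⟨m, hm, hs⟩ := ih (n - min (c a) n) (by omega)
    refine ⟨Function.update m a (min (c a) n), fun i => ?_, ?_⟩
    · rcases eq_or_ne i a with rfl | h
      · simp
      · simpa [h] using hm i
    · rw [Finset.sum_insert has, Finset.sum_update_of_notMem has, hs]
      simp

/-- The fractional assignment with equal loads on the `l` fastest machines can be rounded to an
integral one while at most doubling the loads. -/
theorem exists_integral_prefix_assignment {d : ℕ} {q : ℕ → ℝ} (hq : ∀ k, 0 < q k)
    (hmono : Monotone q) {n l : ℕ} (hl : 1 ≤ l) (hld : l ≤ d)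
    (hn : q (l - 1) * recipSum q l ≤ n) :
    ∃ m : Fin d → ℕ, ∑ i, m i = n ∧
      ∀ i : Fin d, (m i : ℝ) * q i ≤ 2 * (n / recipSum q l) * prefixIndicator d l i := by
  have hS := recipSum_pos hq hl
  set T := (n : ℝ) / recipSum q l with hT
  have hT0 : 0 ≤ T := by positivity
  have hTq : q (l - 1) ≤ T := by rwa [hT, le_div_iff₀ hS]
  let c : Fin d → ℕ := fun i => if (i : ℕ) < l then ⌈T / q i⌉₊ else 0
  have hc : n ≤ ∑ i, c i := by
    have h1 : ∑ i, c i = ∑ k ∈ Finset.range d, if k < l then ⌈T / q k⌉₊ else 0 :=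
      Fin.sum_univ_eq_sum_range (fun k => if k < l then ⌈T / q k⌉₊ else 0) d
    have h2 : ∑ k ∈ Finset.range l, ⌈T / q k⌉₊ ≤ ∑ i, c i := by
      rw [h1]
      calc ∑ k ∈ Finset.range l, ⌈T / q k⌉₊
          = ∑ k ∈ Finset.range l, if k < l then ⌈T / q k⌉₊ else 0 :=
            Finset.sum_congr rfl fun k hk => by rw [if_pos (by simpa using hk)]
        _ ≤ _ := Finset.sum_le_sum_of_subset (by simpa using hld)
    have h3 : (n : ℝ) ≤ ((∑ k ∈ Finset.range l, ⌈T / q k⌉₊ : ℕ) : ℝ) := by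
      push_cast
      calc (n : ℝ) = T * recipSum q l := by rw [hT]; field_simp
        _ = ∑ k ∈ Finset.range l, T / q k := by
          unfold recipSum
          rw [Finset.mul_sum]
          exact Finset.sum_congr rfl fun k _ => mul_one_div _ _
        _ ≤ _ := Finset.sum_le_sum fun k _ => Nat.le_ceil _
    exact le_trans (by exact_mod_cast h3) h2
  obtain ⟨m, hm, hs⟩ := exists_le_sum_eq Finset.univ c n hc
  refine ⟨m, hs, fun i => ?_⟩
  have hmi := hm i
  by_cases hi : (i : ℕ) < l
  · simp only [c, hi, if_true] at hmi
    have h1 : (m i : ℝ) ≤ T / q i + 1 :=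
      (Nat.cast_le.2 hmi).trans (Nat.ceil_lt_add_one (div_nonneg hT0 (hq i).le)).le
    have h2 : q i ≤ T := (hmono (by omega)).trans hTq
    have h3 := mul_le_mul_of_nonneg_right h1 (hq i).le
    have h4 : (T / q i + 1) * q i = T + q i := by field_simp [(hq i).ne']
    simp only [prefixIndicator, hi, if_true]
    linarith
  · simp only [c, hi, if_false] at hmi
    simp [prefixIndicator, hi, Nat.le_zero.1 hmi]

theorem exists_sorted_of_card_support_le {d L : ℕ} {q : ℕ → ℝ} (hq : ∀ k, 0 < q k)
    (hmono : Monotone q) (hLd : L ≤ d) {v : Fin d → ℝ} (hv : ∀ i, 0 ≤ v i)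
    (hcard : (Finset.univ.filter fun i => v i ≠ 0).card ≤ L) :
    ∃ (σ : Equiv.Perm (Fin d)) (z : ℕ → ℝ), Antitone z ∧ (∀ k, 0 ≤ z k) ∧
      (∀ k, L ≤ k → z k = 0) ∧ (∀ i : Fin d, z i = v (σ i)) ∧
      ∑ i : Fin d, v i / q i ≤ ∑ k ∈ Finset.range L, z k / q k := by
  set σ := Tuple.sort (fun i => -v i)
  have hσ : ∀ i j : Fin d, i ≤ j → v (σ j) ≤ v (σ i) := fun i j hij => by
    have := Tuple.monotone_sort (fun i => -v i) hij
    simp only [Function.comp] at this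
    simp only [σ]
    linarith
  let z : ℕ → ℝ := fun k => if h : k < d then v (σ ⟨k, h⟩) else 0
  have hz0 : ∀ k, 0 ≤ z k := fun k => by
    simp only [z]; split_ifs; exacts [hv _, le_rfl]
  have hzi : ∀ i : Fin d, z i = v (σ i) := fun i => by simp [z]
  have hza : Antitone z := fun a b hab => by
    by_cases hb : b < d
    · have ha : a < d := by omega
      simp only [z, ha, hb, dif_pos]
      exact hσ _ _ hab
    · have : z b = 0 := by simp [z, hb]
      rw [this]; exact hz0 a
  have hzL : ∀ k, L ≤ k → z k = 0 := by
    intro k hk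
    by_contra hne
    have hkd : k < d := by
      by_contra h; exact hne (by simp [z, h])
    have hsub : (Finset.univ.filter fun i : Fin d => (i : ℕ) < k + 1).map σ.toEmbedding ⊆
        Finset.univ.filter fun i => v i ≠ 0 := by
      intro j hj
      simp only [Finset.mem_map, Finset.mem_filter, Finset.mem_univ, true_and] at hj ⊢
      obtain ⟨i, hi, rfl⟩ := hj
      have h1 := hza (show (i : ℕ) ≤ k by omega)
      have h2 := lt_of_le_of_ne (hz0 k) (Ne.symm hne)
      simp only [Equiv.coe_toEmbedding]
      rw [← hzi]
      linarith
    have := Finset.card_le_card hsub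
    rw [Finset.card_map, Fin.card_filter_val_lt] at this
    omega
  refine ⟨σ, z, hza, hz0, hzL, hzi, ?_⟩
  have h1 : ∑ k ∈ Finset.range L, z k / q k = ∑ k ∈ Finset.range d, z k / q k := by
    refine Finset.sum_subset (by simpa using hLd) fun k _ hk => ?_
    rw [hzL k (by simpa using hk), zero_div]
  rw [h1, ← Fin.sum_univ_eq_sum_range (fun k => z k / q k) d]
  have hmv : Monovary (fun i : Fin d => v (σ i)) (fun i : Fin d => 1 / q i) := by
    intro i j hij
    have : (j : ℕ) ≤ i := by
      by_contra h
      have h1 := hmono (show (i : ℕ) ≤ j by omega)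
      have := one_div_le_one_div_of_le (hq i) h1
      simp only at hij
      linarith
    exact hσ _ _ this
  have := hmv.sum_mul_comp_perm_le_sum_mul (σ := σ)
  simp only [mul_one_div] at this
  rw [← Equiv.sum_comp σ (fun i : Fin d => v i / q i)]
  simpa [hzi] using this

/-- Every integral assignment dominates, up to a permutation, a nonincreasing vector supported on
the first `L` coordinates that processes at least half of the jobs. -/
theorem exists_sorted_dominated {d n L : ℕ} {q : ℕ → ℝ} (hq : ∀ k, 0 < q k) (hmono : Monotone q)
    (hL : 1 ≤ L) (hLd : L ≤ d) (hLmax : L < d → (n : ℝ) < q L * recipSum q (L + 1))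
    (m : Fin d → ℕ) (hm : ∑ i, m i = n) :
    ∃ (σ : Equiv.Perm (Fin d)) (z : ℕ → ℝ), Antitone z ∧ (∀ k, 0 ≤ z k) ∧
      (∀ k, L ≤ k → z k = 0) ∧ (∀ i : Fin d, z i ≤ (m (σ i) : ℝ) * q (σ i)) ∧
      (n : ℝ) / 2 ≤ ∑ k ∈ Finset.range L, z k / q k := by
  have restrict : ∀ (P : Fin d → Prop) [DecidablePred P],
      (Finset.univ.filter fun i => P i ∧ m i ≠ 0).card ≤ L →
      (n : ℝ) / 2 ≤ ∑ i, (if P i then (m i : ℝ) else 0) →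
      ∃ (σ : Equiv.Perm (Fin d)) (z : ℕ → ℝ), Antitone z ∧ (∀ k, 0 ≤ z k) ∧
      (∀ k, L ≤ k → z k = 0) ∧ (∀ i : Fin d, z i ≤ (m (σ i) : ℝ) * q (σ i)) ∧
      (n : ℝ) / 2 ≤ ∑ k ∈ Finset.range L, z k / q k := by
    intro P _ hc hs
    let v : Fin d → ℝ := fun i => if P i then (m i : ℝ) * q i else 0
    have hmq : ∀ i : Fin d, 0 ≤ (m i : ℝ) * q i := fun i => mul_nonneg (Nat.cast_nonneg _) (hq _).le
    have hv : ∀ i, 0 ≤ v i := fun i => by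
      simp only [v]; split_ifs; exacts [hmq i, le_rfl]
    obtain ⟨σ, z, h1, h2, h3, h4, h5⟩ := exists_sorted_of_card_support_le hq hmono hLd hv (by
      refine le_trans (Finset.card_le_card fun i hi => ?_) hc
      simp only [v, Finset.mem_filter, Finset.mem_univ, true_and] at hi ⊢
      split_ifs at hi with hP
      · exact ⟨hP, fun h => hi (by simp [h])⟩
      · exact absurd rfl hi)
    refine ⟨σ, z, h1, h2, h3, fun i => ?_, hs.trans (le_trans (le_of_eq ?_) h5)⟩
    · rw [h4]; simp only [v]; split_ifs; exacts [le_rfl, hmq _]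
    · refine Finset.sum_congr rfl fun i _ => ?_
      simp only [v]
      split_ifs
      · rw [mul_div_cancel_right₀ _ (hq i).ne']
      · simp
  by_cases hb : L ≤ (Finset.univ.filter fun i : Fin d => ¬ (i : ℕ) < L ∧ m i ≠ 0).card
  · obtain ⟨B, hBsub, hBcard⟩ := Finset.exists_subset_card_eq hb
    have hLd' : L < d := by
      obtain ⟨i, hi⟩ := Finset.card_pos.1 (show 0 < B.card by omega)
      have := hBsub hi
      simp at this
      omega
    have hA : (Finset.univ.filter fun i : Fin d => (i : ℕ) < L).card = B.card := by
      rw [Fin.card_filter_val_lt, hBcard]; omega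
    let e₀ := Finset.equivOfCardEq hA
    let e : {i : Fin d // (i : ℕ) < L} ≃ {i // i ∈ B} :=
      (Equiv.subtypeEquivRight fun i => by simp).trans e₀
    refine ⟨e.extendSubtype, fun k => if k < L then q L else 0, fun a b hab => ?_, fun k => ?_,
      fun k hk => ?_, fun i => ?_, ?_⟩
    · have := (hq L).le
      dsimp only
      split_ifs <;> linarith
    · have := (hq L).le
      dsimp only
      split_ifs <;> linarith
    · simp; omega
    · dsimp only
      split_ifs with hi
      · have := hBsub (e.extendSubtype_mem i hi)
        simp only [Finset.mem_filter, Finset.mem_univ, true_and] at this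
        have h1 : (1 : ℝ) ≤ m (e.extendSubtype i) := by
          exact_mod_cast Nat.one_le_iff_ne_zero.2 this.2
        have h2 : q L ≤ q (e.extendSubtype i) := hmono (by omega)
        have := (hq L).le
        nlinarith
      · exact mul_nonneg (Nat.cast_nonneg _) (hq _).le
    · have h1 : ∑ k ∈ Finset.range L, (if k < L then q L else 0) / q k = q L * recipSum q L := by
        unfold recipSum
        rw [Finset.mul_sum]
        refine Finset.sum_congr rfl fun k hk => ?_
        rw [if_pos (by simpa using hk), mul_one_div]
      rw [h1]
      have h2 := hLmax hLd'
      have h3 : q L * recipSum q (L + 1) = q L * recipSum q L + 1 := by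
        unfold recipSum
        rw [Finset.sum_range_succ, mul_add, mul_one_div_cancel (hq L).ne']
      have h4 : 1 ≤ q L * recipSum q L := by
        have h5 : recipSum q 1 ≤ recipSum q L := recipSum_mono hq hL
        have h6 : recipSum q 1 = 1 / q 0 := by simp [recipSum]
        rw [h6] at h5
        have h7 := hmono (Nat.zero_le L)
        calc (1 : ℝ) = q 0 * (1 / q 0) := by rw [mul_one_div_cancel (hq 0).ne']
          _ ≤ q L * recipSum q L := mul_le_mul h7 h5 (one_div_pos.2 (hq 0)).le (hq L).le
      linarith
  · have hsum : (∑ i : Fin d, (if (i : ℕ) < L then (m i : ℝ) else 0)) +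
        ∑ i : Fin d, (if ¬ (i : ℕ) < L then (m i : ℝ) else 0) = n := by
      rw [← Finset.sum_add_distrib, ← hm]
      push_cast
      refine Finset.sum_congr rfl fun i _ => ?_
      by_cases h : (i : ℕ) < L <;> simp [h]
    by_cases h : (n : ℝ) / 2 ≤ ∑ i : Fin d, (if (i : ℕ) < L then (m i : ℝ) else 0)
    · refine restrict (fun i => (i : ℕ) < L) ?_ h
      refine le_trans (Finset.card_le_card (t := Finset.univ.filter fun i : Fin d => (i : ℕ) < L)
        fun i hi => ?_) ?_
      · simp at hi ⊢; exact hi.1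
      · rw [Fin.card_filter_val_lt]; omega
    · exact restrict (fun i => ¬ (i : ℕ) < L) (by omega) (by linarith)

/-- Extension of a weight vector to a sequence by zeros. -/
noncomputable def weightSeq {d : ℕ} (w : Fin d → ℝ) (k : ℕ) : ℝ := if h : k < d then w ⟨k, h⟩ else 0

theorem weightSeq_nonneg {d : ℕ} {w : Fin d → ℝ} (hw : IsWeightVector w) (k : ℕ) :
    0 ≤ weightSeq w k := by
  unfold weightSeq; split_ifs; exacts [hw.2.1 _, le_rfl]

theorem weightSeq_antitone {d : ℕ} {w : Fin d → ℝ} (hw : IsWeightVector w) :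
    Antitone (weightSeq w) := fun a b hab => by
  by_cases hb : b < d
  · have ha : a < d := by omega
    simp only [weightSeq, ha, hb, dif_pos]
    exact hw.1 hab
  · have : weightSeq w b = 0 := by simp [weightSeq, hb]
    rw [this]; exact weightSeq_nonneg hw a

theorem sum_weightSeq_le {d : ℕ} {w : Fin d → ℝ} (hw : IsWeightVector w) {l l' : ℕ} (h : l ≤ l') :
    l * ∑ k ∈ Finset.range l', weightSeq w k ≤ l' * ∑ k ∈ Finset.range l, weightSeq w k := by
  induction l', h using Nat.le_induction with
  | base => exact le_rfl
  | succ l' hl ih =>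
    rw [Finset.sum_range_succ]
    have : ∑ k ∈ Finset.range l, weightSeq w l' ≤ ∑ k ∈ Finset.range l, weightSeq w k :=
      Finset.sum_le_sum fun k hk => weightSeq_antitone hw (by simp at hk; omega)
    simp only [Finset.sum_const, Finset.card_range, nsmul_eq_mul] at this
    push_cast
    linarith

theorem absSortDesc_antitone {d : ℕ} (x : Fin d → ℝ) : Antitone (absSortDesc x) := fun _ _ hab =>
  Tuple.monotone_sort (fun i => |x i|) (Fin.rev_le_rev.2 hab)

theorem exists_perm_absSortDesc {d : ℕ} (x : Fin d → ℝ) :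
    ∃ τ : Equiv.Perm (Fin d), ∀ k, absSortDesc x k = |x (τ k)| :=
  ⟨Fin.revPerm.trans (Tuple.sort fun i => |x i|), fun _ => rfl⟩

theorem sum_mul_abs_comp_perm_le_orderedNorm {d : ℕ} {w : Fin d → ℝ} (hw : Antitone w)
    (x : Fin d → ℝ) (σ : Equiv.Perm (Fin d)) : ∑ k, w k * |x (σ k)| ≤ orderedNorm w x := by
  obtain ⟨τ, hτ⟩ := exists_perm_absSortDesc x
  have hmv : Monovary w (absSortDesc x) := hw.monovary (absSortDesc_antitone x)
  have := hmv.sum_mul_comp_perm_le_sum_mul (σ := σ.trans τ.symm)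
  simpa [orderedNorm, hτ] using this

theorem orderedNorm_comp_perm {d : ℕ} (w x : Fin d → ℝ) (σ : Equiv.Perm (Fin d)) :
    orderedNorm w (x ∘ σ) = orderedNorm w x := by
  have h := Tuple.comp_perm_comp_sort_eq_comp_sort (f := fun i => |x i|) (σ := σ)
  unfold orderedNorm
  refine Finset.sum_congr rfl fun k _ => ?_
  exact congrArg (w k * ·) (congrFun h k.rev)

theorem orderedNorm_mono {d : ℕ} {w : Fin d → ℝ} (hw : IsWeightVector w) {x y : Fin d → ℝ}
    (hx : ∀ i, 0 ≤ x i) (hxy : ∀ i, x i ≤ y i) : orderedNorm w x ≤ orderedNorm w y := by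
  obtain ⟨τ, hτ⟩ := exists_perm_absSortDesc x
  refine le_trans ?_ (sum_mul_abs_comp_perm_le_orderedNorm hw.1 y τ)
  unfold orderedNorm
  refine Finset.sum_le_sum fun k _ => mul_le_mul_of_nonneg_left ?_ (hw.2.1 k)
  rw [hτ]
  exact abs_le_abs_of_nonneg (hx _) (hxy _)

theorem orderedNorm_of_antitone {d : ℕ} {w : Fin d → ℝ} (hw : IsWeightVector w) {x : Fin d → ℝ}
    (hx : ∀ i, 0 ≤ x i) (ha : Antitone x) : orderedNorm w x = ∑ k, w k * x k := by
  apply le_antisymm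
  · obtain ⟨τ, hτ⟩ := exists_perm_absSortDesc x
    have := (hw.1.monovary ha).sum_mul_comp_perm_le_sum_mul (σ := τ)
    unfold orderedNorm
    simpa only [hτ, abs_of_nonneg (hx _)] using this
  · have := sum_mul_abs_comp_perm_le_orderedNorm hw.1 x (Equiv.refl _)
    simpa only [Equiv.refl_apply, abs_of_nonneg (hx _)] using this

theorem sum_mul_eq_sum_range_weightSeq {d L : ℕ} (w : Fin d → ℝ) {z : ℕ → ℝ} (hLd : L ≤ d)
    (hz : ∀ k, L ≤ k → z k = 0) :
    ∑ i : Fin d, w i * z i = ∑ k ∈ Finset.range L, weightSeq w k * z k := by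
  have h1 : ∑ i : Fin d, w i * z i = ∑ i : Fin d, weightSeq w i * z i :=
    Finset.sum_congr rfl fun i _ => by simp [weightSeq]
  rw [h1, Fin.sum_univ_eq_sum_range (fun k => weightSeq w k * z k) d]
  symm
  refine Finset.sum_subset (by simpa using hLd) fun k _ hk => ?_
  rw [hz k (by simpa using hk), mul_zero]

theorem orderedNorm_mul_prefixIndicator {d l : ℕ} {w : Fin d → ℝ} (hw : IsWeightVector w)
    (hl : l ≤ d) {c : ℝ} (hc : 0 ≤ c) :
    orderedNorm w (fun i => c * prefixIndicator d l i) =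
      c * ∑ k ∈ Finset.range l, weightSeq w k := by
  rw [orderedNorm_of_antitone hw]
  · have := sum_mul_eq_sum_range_weightSeq w (z := fun k => c * if k < l then 1 else 0) hl
      (fun k hk => by simp; omega)
    simp only [prefixIndicator]
    rw [this, Finset.mul_sum]
    refine Finset.sum_congr rfl fun k hk => ?_
    rw [if_pos (by simpa using hk)]; ring
  · intro i; unfold prefixIndicator; split_ifs <;> simp [hc]
  · intro i j hij
    have : (i : ℕ) ≤ j := hij
    dsimp only
    unfold prefixIndicator
    split_ifs
    · exact le_rfl
    · exfalso; omega
    · simpa using hc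
    · exact le_rfl

theorem prefixIndicator_nonneg {d : ℕ} (l : ℕ) (i : Fin d) : 0 ≤ prefixIndicator d l i := by
  unfold prefixIndicator; split_ifs <;> norm_num

theorem prefixIndicator_mono {d a b : ℕ} (h : a ≤ b) (i : Fin d) :
    prefixIndicator d a i ≤ prefixIndicator d b i := by
  unfold prefixIndicator
  split_ifs <;> first | (exfalso; omega) | norm_num

namespace IsSymMonotoneNorm

variable {d : ℕ} {f : (Fin d → ℝ) → ℝ}

theorem nonneg (hf : IsSymMonotoneNorm f) {x : Fin d → ℝ} (hx : ∀ i, 0 ≤ x i) : 0 ≤ f x := by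
  have h0 : f 0 = 0 := (hf.1 0).2 rfl
  rw [← h0]
  exact hf.2.2.2.2 0 x (fun _ => le_rfl) hx

theorem prefixIndicator_add_le (hf : IsSymMonotoneNorm f) (a b : ℕ) :
    f (prefixIndicator d (a + b)) ≤ f (prefixIndicator d a) + f (prefixIndicator d b) := by
  by_cases ha : a < d
  · have : NeZero d := ⟨by omega⟩
    let s : Equiv.Perm (Fin d) := Equiv.subRight (⟨a, ha⟩ : Fin d)
    calc f (prefixIndicator d (a + b))
        ≤ f (prefixIndicator d a + prefixIndicator d b ∘ s) := by
          refine hf.2.2.2.2 _ _ (prefixIndicator_nonneg _) fun i => ?_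
          by_cases hi : (i : ℕ) < a
          · have := prefixIndicator_nonneg b (s i)
            have h1 : prefixIndicator d a i = 1 := by simp [prefixIndicator, hi]
            have h2 : prefixIndicator d (a + b) i ≤ 1 := by
              unfold prefixIndicator; split_ifs <;> norm_num
            simp only [Pi.add_apply, Function.comp]
            linarith
          · have hs : ((s i : Fin d) : ℕ) = i - a :=
              Fin.sub_val_of_le (show (⟨a, ha⟩ : Fin d) ≤ i from not_lt.1 hi)
            simp only [Pi.add_apply, Function.comp, prefixIndicator, hs, hi, if_false, zero_add]
            split_ifs <;> first | (exfalso; omega) | norm_num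
      _ ≤ f (prefixIndicator d a) + f (prefixIndicator d b ∘ s) := hf.2.2.1 _ _
      _ = _ := by rw [hf.2.2.2.1]
  · have h1 : prefixIndicator d (a + b) = prefixIndicator d a := by
      funext i
      have := i.2
      simp [prefixIndicator, show (i : ℕ) < a + b by omega, show (i : ℕ) < a by omega]
    rw [h1]
    have := hf.nonneg (prefixIndicator_nonneg (d := d) b)
    linarith

theorem prefixIndicator_mul_le (hf : IsSymMonotoneNorm f) (c l : ℕ) :
    f (prefixIndicator d (c * l)) ≤ c * f (prefixIndicator d l) := by
  induction c with
  | zero =>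
    have : prefixIndicator d (0 * l) = 0 := by funext i; simp [prefixIndicator]
    rw [this, (hf.1 0).2 rfl]
    simp
  | succ c ih =>
    rw [add_mul, one_mul]
    have := hf.prefixIndicator_add_le (c * l) l
    push_cast
    linarith

theorem mul_prefixIndicator_le (hf : IsSymMonotoneNorm f) {l l' : ℕ} (hl : 1 ≤ l) (h : l ≤ l') :
    l * f (prefixIndicator d l') ≤ 2 * l' * f (prefixIndicator d l) := by
  have h1 : l' ≤ (l' / l + 1) * l := by
    have := Nat.lt_div_mul_add (a := l') (b := l) hl
    rw [add_mul, one_mul]; omega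
  have h2 : f (prefixIndicator d l') ≤ f (prefixIndicator d ((l' / l + 1) * l)) :=
    hf.2.2.2.2 _ _ (prefixIndicator_nonneg _) (prefixIndicator_mono h1)
  have h3 := hf.prefixIndicator_mul_le (l' / l + 1) l
  have h4 : l * (l' / l + 1) ≤ 2 * l' := by
    have := Nat.mul_div_le l' l
    rw [mul_add, mul_one]; omega
  have h5 := hf.nonneg (prefixIndicator_nonneg (d := d) l)
  calc l * f (prefixIndicator d l')
      ≤ l * (((l' / l + 1 : ℕ) : ℝ) * f (prefixIndicator d l)) :=
        mul_le_mul_of_nonneg_left (h2.trans h3) (Nat.cast_nonneg _)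
    _ = ((l * (l' / l + 1) : ℕ) : ℝ) * f (prefixIndicator d l) := by push_cast; ring
    _ ≤ ((2 * l' : ℕ) : ℝ) * f (prefixIndicator d l) :=
        mul_le_mul_of_nonneg_right (by exact_mod_cast h4) h5
    _ = _ := by push_cast; ring

theorem prefixIndicator_pos (hf : IsSymMonotoneNorm f) {l : ℕ} (hl : 1 ≤ l) (hd : 1 ≤ d) :
    0 < f (prefixIndicator d l) := by
  refine lt_of_le_of_ne (hf.nonneg (prefixIndicator_nonneg _)) fun h => ?_
  have := congrFun ((hf.1 _).1 h.symm) ⟨0, hd⟩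
  simp [prefixIndicator] at this
  omega

theorem mul_prefixIndicator_eq (hf : IsSymMonotoneNorm f) {c : ℝ} (hc : 0 ≤ c) (l : ℕ) :
    f (fun i => c * prefixIndicator d l i) = c * f (prefixIndicator d l) := by
  have := hf.2.1 c (prefixIndicator d l)
  rwa [abs_of_nonneg hc] at this

end IsSymMonotoneNorm

theorem exists_orderedNorm_prefix_le {d n L : ℕ} {q : ℕ → ℝ} (hq : ∀ k, 0 < q k)
    (hL : 1 ≤ L) (hLd : L ≤ d) {w y : Fin d → ℝ} (hw : IsWeightVector w)
    (σ : Equiv.Perm (Fin d)) {z : ℕ → ℝ} (hz : Antitone z) (hz0 : ∀ k, 0 ≤ z k)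
    (hzL : ∀ k, L ≤ k → z k = 0) (hzy : ∀ i : Fin d, z i ≤ y (σ i))
    (hn : (n : ℝ) / 2 ≤ ∑ k ∈ Finset.range L, z k / q k) :
    ∃ l, 1 ≤ l ∧ l ≤ L ∧
      n / recipSum q l * ∑ k ∈ Finset.range l, weightSeq w k ≤ 2 * orderedNorm w y := by
  obtain ⟨l, hl, hmin⟩ := Finset.exists_min_image (Finset.Icc 1 L)
    (fun l => (∑ k ∈ Finset.range l, weightSeq w k) / recipSum q l) ⟨1, by simp [hL]⟩
  rw [Finset.mem_Icc] at hl
  refine ⟨l, hl.1, hl.2, ?_⟩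
  set μ := (∑ k ∈ Finset.range l, weightSeq w k) / recipSum q l with hμ
  have hμ0 : 0 ≤ μ := div_nonneg (Finset.sum_nonneg fun k _ => weightSeq_nonneg hw k)
    (recipSum_pos hq hl.1).le
  have habel := sum_mul_nonneg_of_partial_sums_nonneg (a := fun k => weightSeq w k - μ * (1 / q k))
    hz L (by
      intro j hj
      rw [Finset.sum_sub_distrib, ← Finset.mul_sum]
      rcases Nat.eq_zero_or_pos j with rfl | hj0
      · simp
      · have := hmin j (Finset.mem_Icc.2 ⟨hj0, hj⟩)
        rw [le_div_iff₀ (recipSum_pos hq hj0)] at this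
        unfold recipSum at this
        exact sub_nonneg.2 this)
  rw [hzL L le_rfl, zero_mul] at habel
  have h1 : ∑ k ∈ Finset.range L, (weightSeq w k - μ * (1 / q k)) * z k =
      ∑ k ∈ Finset.range L, weightSeq w k * z k - μ * ∑ k ∈ Finset.range L, z k / q k := by
    rw [Finset.mul_sum, ← Finset.sum_sub_distrib]
    exact Finset.sum_congr rfl fun k _ => by ring
  rw [h1] at habel
  have h2 : ∑ k ∈ Finset.range L, weightSeq w k * z k ≤ orderedNorm w y := by
    rw [← sum_mul_eq_sum_range_weightSeq w hLd hzL, ← orderedNorm_comp_perm w y σ,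
      ← orderedNorm_of_antitone hw (x := fun i : Fin d => z i) (fun i => hz0 i)
        (fun i j hij => hz hij)]
    exact orderedNorm_mono hw (fun i => hz0 i) hzy
  have h3 := mul_le_mul_of_nonneg_left hn hμ0
  have h4 : (n : ℝ) / recipSum q l * ∑ k ∈ Finset.range l, weightSeq w k = n * μ := by
    rw [hμ]; ring
  rw [h4]
  linarith

theorem exists_symMonotoneNorm_prefix_le {d n L : ℕ} {q : ℕ → ℝ} (hq : ∀ k, 0 < q k)
    (hmono : Monotone q) (hn1 : 1 ≤ n) (hL : 1 ≤ L) (hLd : L ≤ d) {f : (Fin d → ℝ) → ℝ}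
    (hf : IsSymMonotoneNorm f) {y : Fin d → ℝ}
    (σ : Equiv.Perm (Fin d)) {z : ℕ → ℝ} (hz : Antitone z) (hz0 : ∀ k, 0 ≤ z k)
    (hzy : ∀ i : Fin d, z i ≤ y (σ i))
    (hn : (n : ℝ) / 2 ≤ ∑ k ∈ Finset.range L, z k / q k) :
    ∃ l, 1 ≤ l ∧ l ≤ L ∧
      n / recipSum q l * f (prefixIndicator d l) ≤ 2 * (1 + Real.log d) * f y := by
  by_contra! hcon
  have hn0 : (0 : ℝ) < n := by exact_mod_cast hn1
  have hd0 : (1 : ℝ) ≤ d := by exact_mod_cast hL.trans hLd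
  set H := 1 + Real.log d with hH
  have hH0 : 0 < H := by have := Real.log_nonneg hd0; linarith
  have hterm : ∀ k ∈ Finset.range L, 2 * H * (z k / q k) < n * (1 / ((k : ℝ) + 1)) := by
    intro k hk
    have hkL : k + 1 ≤ L := by simp at hk; omega
    have h1 := hcon (k + 1) (by omega) hkL
    have hF := hf.prefixIndicator_pos (l := k + 1) (by omega) (by omega : 1 ≤ d)
    have hS := recipSum_pos hq (l := k + 1) (by omega)
    have h2 : z k * f (prefixIndicator d (k + 1)) ≤ f y := by
      rw [← hf.mul_prefixIndicator_eq (hz0 k), ← hf.2.2.2.1 σ y]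
      refine hf.2.2.2.2 _ _ (fun i => mul_nonneg (hz0 k) (prefixIndicator_nonneg _ i)) fun i => ?_
      refine le_trans ?_ (hzy i)
      unfold prefixIndicator
      split_ifs with hi
      · rw [mul_one]; exact hz (by omega)
      · rw [mul_zero]; exact hz0 _
    have h3 : 2 * H * z k < n / recipSum q (k + 1) := by
      by_contra! h
      have := mul_le_mul_of_nonneg_right h hF.le
      have := mul_le_mul_of_nonneg_left h2 (show 0 ≤ 2 * H by linarith)
      linarith
    have h4 := natCast_le_mul_recipSum hq hmono k
    have hk0 : (0 : ℝ) < k + 1 := by positivity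
    rw [lt_div_iff₀ hS] at h3
    rw [mul_one_div, lt_div_iff₀ hk0, ← mul_div_assoc, div_mul_eq_mul_div, div_lt_iff₀ (hq k)]
    have h5 := mul_le_mul_of_nonneg_left h4 (show 0 ≤ 2 * H * z k by
      have := hz0 k; positivity)
    have h6 := mul_lt_mul_of_pos_right h3 (hq k)
    linarith
  have hsum := Finset.sum_lt_sum_of_nonempty ⟨0, by simp; omega⟩ hterm
  rw [← Finset.mul_sum, ← Finset.mul_sum] at hsum
  have hharm : ∑ k ∈ Finset.range L, (1 / ((k : ℝ) + 1)) ≤ H := by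
    have h1 := harmonic_le_one_add_log L
    have h2 : Real.log L ≤ Real.log d :=
      Real.log_le_log (by exact_mod_cast hL) (by exact_mod_cast hLd)
    have h3 : ((harmonic L : ℚ) : ℝ) = ∑ k ∈ Finset.range L, (1 / ((k : ℝ) + 1)) := by
      simp [harmonic]
    linarith
  have h1 := mul_le_mul_of_nonneg_left hharm hn0.le
  have h2 := mul_le_mul_of_nonneg_left hn (show 0 ≤ 2 * H by linarith)
  nlinarith

theorem exists_geometric_cover {β : ℝ} (hβ : 1 < β) {K l L : ℕ} (hK : (L : ℝ) ≤ β ^ K)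
    (hl : 1 ≤ l) (hlL : l ≤ L) :
    ∃ k ≤ K, l ≤ min ⌊β ^ k⌋₊ L ∧ ((min ⌊β ^ k⌋₊ L : ℕ) : ℝ) ≤ β * l := by
  have hlK : (l : ℝ) ≤ β ^ K := le_trans (by exact_mod_cast hlL) hK
  have hex : ∃ k, (l : ℝ) ≤ β ^ k := ⟨K, hlK⟩
  classical
  refine ⟨Nat.find hex, Nat.find_min' hex hlK, le_min (Nat.le_floor (Nat.find_spec hex)) hlL, ?_⟩
  have hl1 : (1 : ℝ) ≤ l := by exact_mod_cast hl
  have h1 : ((min ⌊β ^ Nat.find hex⌋₊ L : ℕ) : ℝ) ≤ β ^ Nat.find hex :=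
    le_trans (Nat.cast_le.2 (min_le_left _ _)) (Nat.floor_le (by positivity))
  refine h1.trans ?_
  rcases h : Nat.find hex with _ | k
  · simp only [pow_zero]; nlinarith
  · have h2 := Nat.find_min hex (m := k) (by omega)
    rw [pow_succ, mul_comm]
    exact mul_le_mul_of_nonneg_left (not_le.1 h2).le (by linarith)

theorem exists_critical_prefix {d n : ℕ} {q : ℕ → ℝ} (hq : ∀ k, 0 < q k) (hd : 1 ≤ d)
    (hn : 1 ≤ n) :
    ∃ L, 1 ≤ L ∧ L ≤ d ∧ q (L - 1) * recipSum q L ≤ n ∧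
      (L < d → (n : ℝ) < q L * recipSum q (L + 1)) := by
  classical
  let P : ℕ → Prop := fun l => 1 ≤ l ∧ q (l - 1) * recipSum q l ≤ n
  have hP1 : P 1 := by
    refine ⟨le_rfl, ?_⟩
    have : q (1 - 1) * recipSum q 1 = 1 := by
      simp [recipSum, mul_inv_cancel₀ (hq 0).ne']
    rw [this]; exact_mod_cast hn
  have hspec : P (Nat.findGreatest P d) := Nat.findGreatest_spec hd hP1
  refine ⟨Nat.findGreatest P d, hspec.1, Nat.findGreatest_le d, hspec.2, fun h => ?_⟩
  have := Nat.findGreatest_is_greatest (Nat.lt_succ_self (Nat.findGreatest P d)) h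
  by_contra! hc
  exact this ⟨by omega, hc⟩

/-- The portfolio for machines sorted by processing time. -/
theorem exists_sorted_portfolio {d n K : ℕ} {q : ℕ → ℝ} (hq : ∀ k, 0 < q k) (hmono : Monotone q)
    (hd : 1 ≤ d) (hn : 1 ≤ n) {β : ℝ} (hβ : 1 < β) (hK : (d : ℝ) ≤ β ^ K) :
    ∃ x : ℕ → Fin d → ℕ, (∀ k, ∑ i, x k i = n) ∧
      (∀ w : Fin d → ℝ, IsWeightVector w → ∀ m : Fin d → ℕ, ∑ i, m i = n →
        ∃ k ≤ K, orderedNorm w (fun i => (x k i : ℝ) * q i) ≤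
          4 * β * orderedNorm w (fun i => (m i : ℝ) * q i)) ∧
      (∀ f : (Fin d → ℝ) → ℝ, IsSymMonotoneNorm f → ∀ m : Fin d → ℕ, ∑ i, m i = n →
        ∃ k ≤ K, f (fun i => (x k i : ℝ) * q i) ≤
          8 * β * (1 + Real.log d) * f (fun i => (m i : ℝ) * q i)) := by
  obtain ⟨L, hL, hLd, hLn, hLmax⟩ := exists_critical_prefix hq hd hn
  have hround : ∀ k : ℕ, ∃ m : Fin d → ℕ, ∑ i, m i = n ∧
      ∀ i : Fin d, (m i : ℝ) * q i ≤
        2 * (n / recipSum q (min ⌊β ^ k⌋₊ L)) * prefixIndicator d (min ⌊β ^ k⌋₊ L) i := by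
    intro k
    have h1 : 1 ≤ min ⌊β ^ k⌋₊ L :=
      le_min (Nat.le_floor (by simpa using one_le_pow₀ hβ.le)) hL
    refine exists_integral_prefix_assignment hq hmono h1 ((min_le_right _ _).trans hLd)
      (le_trans ?_ hLn)
    exact mul_le_mul (hmono (by omega)) (recipSum_mono hq (min_le_right _ _))
      (recipSum_pos hq h1).le (hq _).le
  choose x hxsum hxle using hround
  have hLK : (L : ℝ) ≤ β ^ K := le_trans (by exact_mod_cast hLd) hK
  have hx0 : ∀ k (i : Fin d), 0 ≤ (x k i : ℝ) * q i := fun k i =>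
    mul_nonneg (Nat.cast_nonneg _) (hq _).le
  have key : ∀ {l g : ℕ} {c A B D : ℝ}, 1 ≤ l → l ≤ g → (g : ℝ) ≤ β * l → 0 ≤ B → 0 ≤ c →
      l * A ≤ c * g * B → n / recipSum q l * B ≤ D →
      2 * (n / recipSum q g) * A ≤ 2 * c * β * D := by
    intro l g c A B D hl hlg hgl hB hc hA hD
    have hl0 : (0 : ℝ) < l := by exact_mod_cast hl
    have hSl := recipSum_pos hq hl
    have hA' : A ≤ c * β * B := by
      have h1 := mul_le_mul_of_nonneg_left hgl (mul_nonneg hc hB)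
      have h2 : l * A ≤ l * (c * β * B) := by linarith
      exact le_of_mul_le_mul_left h2 hl0
    have hT : (n : ℝ) / recipSum q g ≤ n / recipSum q l :=
      div_le_div_of_nonneg_left (Nat.cast_nonneg _) hSl (recipSum_mono hq hlg)
    have hT0 : 0 ≤ (n : ℝ) / recipSum q g :=
      div_nonneg (Nat.cast_nonneg _) (recipSum_pos hq (hl.trans hlg)).le
    have hcβ : 0 ≤ c * β := mul_nonneg hc (by linarith)
    calc 2 * (n / recipSum q g) * A ≤ 2 * (n / recipSum q g) * (c * β * B) :=
          mul_le_mul_of_nonneg_left hA' (by linarith)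
      _ ≤ 2 * (n / recipSum q l) * (c * β * B) :=
          mul_le_mul_of_nonneg_right (by linarith) (mul_nonneg hcβ hB)
      _ = 2 * c * β * (n / recipSum q l * B) := by ring
      _ ≤ 2 * c * β * D := mul_le_mul_of_nonneg_left hD (by linarith)
  refine ⟨x, hxsum, fun w hw m hm => ?_, fun f hf m hm => ?_⟩
  · obtain ⟨σ, z, hz, hz0, hzL, hzy, hzn⟩ :=
      exists_sorted_dominated hq hmono hL hLd hLmax m hm
    obtain ⟨l, hl, hlL, hle⟩ := exists_orderedNorm_prefix_le
      (y := fun i => (m i : ℝ) * q i) hq hL hLd hw σ hz hz0 hzL hzy hzn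
    obtain ⟨k, hk, hlg, hgl⟩ := exists_geometric_cover hβ hLK hl hlL
    refine ⟨k, hk, (orderedNorm_mono hw (hx0 k) (hxle k)).trans ?_⟩
    rw [orderedNorm_mul_prefixIndicator hw ((min_le_right _ _).trans hLd)
      (mul_nonneg zero_le_two (div_nonneg (Nat.cast_nonneg _)
        (recipSum_pos hq (hl.trans hlg)).le))]
    refine (key (c := 1) hl hlg hgl (Finset.sum_nonneg fun k _ => weightSeq_nonneg hw k)
      zero_le_one (by simpa using sum_weightSeq_le hw hlg) hle).trans (le_of_eq (by ring))
  · obtain ⟨σ, z, hz, hz0, hzL, hzy, hzn⟩ :=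
      exists_sorted_dominated hq hmono hL hLd hLmax m hm
    obtain ⟨l, hl, hlL, hle⟩ := exists_symMonotoneNorm_prefix_le
      (y := fun i => (m i : ℝ) * q i) hq hmono hn hL hLd hf σ hz hz0 hzy hzn
    obtain ⟨k, hk, hlg, hgl⟩ := exists_geometric_cover hβ hLK hl hlL
    refine ⟨k, hk, (hf.2.2.2.2 _ _ (hx0 k) (hxle k)).trans ?_⟩
    rw [hf.mul_prefixIndicator_eq (mul_nonneg zero_le_two (div_nonneg (Nat.cast_nonneg _)
        (recipSum_pos hq (hl.trans hlg)).le))]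
    refine (key (c := 2) hl hlg hgl (hf.nonneg (prefixIndicator_nonneg _)) zero_le_two
      (hf.mul_prefixIndicator_le hl hlg) hle).trans (le_of_eq (by ring))

/-- Theorem 1 (upper bound): portfolios for Machine-Loads-Identical-Jobs. -/
theorem stmt0 :
    ∃ C : ℝ, 0 < C ∧
      ∀ d : ℕ, 2 ≤ d →
      ∀ α : ℝ, 4 < α →
      ∀ p : Fin d → ℝ, (∀ i, 0 < p i) →
      ∀ n : ℕ, 1 ≤ n →
      ∃ X : Set (Fin d → ℝ), X ⊆ MLIJ p n ∧ X.Finite ∧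
        (X.ncard : ℝ) ≤ C * (1 + Real.log d / Real.log (α / 4)) ∧
        (∀ w : Fin d → ℝ, IsWeightVector w →
          ∀ y ∈ MLIJ p n, ∃ x ∈ X, orderedNorm w x ≤ α * orderedNorm w y) ∧
        (∀ f : (Fin d → ℝ) → ℝ, IsSymMonotoneNorm f →
          ∀ y ∈ MLIJ p n, ∃ x ∈ X, f x ≤ C * α * Real.log d * f y) := by
  refine ⟨6, by norm_num, fun d hd α hα p hp n hn => ?_⟩
  have hβ : 1 < α / 4 := by linarith
  have hlogβ : 0 < Real.log (α / 4) := Real.log_pos hβ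
  have hd2 : (2 : ℝ) ≤ d := by exact_mod_cast hd
  have hlogd : Real.log 2 ≤ Real.log d := Real.log_le_log (by norm_num) hd2
  have hlog2 := Real.log_two_gt_d9
  set π := Tuple.sort p
  let q : ℕ → ℝ := fun k => p (π ⟨min k (d - 1), by omega⟩)
  have hq : ∀ k, 0 < q k := fun k => hp _
  have hmono : Monotone q := fun a b hab =>
    Tuple.monotone_sort p (show (⟨min a (d - 1), _⟩ : Fin d) ≤ ⟨min b (d - 1), _⟩ from
      min_le_min_right _ hab)
  have hqi : ∀ i : Fin d, q i = p (π i) := fun i => by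
    have : min (i : ℕ) (d - 1) = i := by omega
    simp only [q, this]
  set K := ⌈Real.log d / Real.log (α / 4)⌉₊ with hKdef
  have hK : (d : ℝ) ≤ (α / 4) ^ K := by
    have h1 : Real.log d / Real.log (α / 4) ≤ K := Nat.le_ceil _
    rw [div_le_iff₀ hlogβ, ← Real.log_pow] at h1
    exact (Real.log_le_log_iff (by linarith) (by positivity)).1 h1
  obtain ⟨x, hxsum, hord, hsym⟩ :=
    exists_sorted_portfolio hq hmono (by omega : 1 ≤ d) hn hβ hK
  let v : ℕ → Fin d → ℝ := fun k i => (x k (π.symm i) : ℝ) * p i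
  have hv : ∀ k, v k ∘ π = fun i => (x k i : ℝ) * q i := fun k => by
    funext i; simp [v, hqi]
  have hy : ∀ y : Fin d → ℝ, ∀ m : Fin d → ℕ, (∀ i, y i = (m i : ℝ) * p i) →
      y ∘ π = fun i => (m (π i) : ℝ) * q i := fun y m h => by
    funext i; simp [h, hqi]
  refine ⟨v '' (Finset.range (K + 1) : Set ℕ), ?_, (Finset.finite_toSet _).image v, ?_, ?_, ?_⟩
  · rintro _ ⟨k, -, rfl⟩
    exact ⟨fun i => x k (π.symm i), by rw [Equiv.sum_comp π.symm (x k), hxsum], fun i => rfl⟩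
  · have h1 : (v '' (Finset.range (K + 1) : Set ℕ)).ncard ≤ K + 1 := by
      refine (Set.ncard_image_le (Finset.finite_toSet _)).trans ?_
      rw [Set.ncard_coe_finset, Finset.card_range]
    have h0 : 0 ≤ Real.log d / Real.log (α / 4) := div_nonneg (by linarith) hlogβ.le
    have h2 : (K : ℝ) < Real.log d / Real.log (α / 4) + 1 := Nat.ceil_lt_add_one h0
    have h3 : ((v '' (Finset.range (K + 1) : Set ℕ)).ncard : ℝ) ≤ K + 1 := by exact_mod_cast h1
    linarith
  · rintro w hw y ⟨m, hm, hym⟩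
    obtain ⟨k, hk, h⟩ := hord w hw (m ∘ π) (by rw [← hm]; exact Equiv.sum_comp π m)
    refine ⟨v k, ⟨k, by simp; omega, rfl⟩, ?_⟩
    have e := hy y m hym
    simp only [Function.comp] at h
    rw [← hv, ← e, orderedNorm_comp_perm, orderedNorm_comp_perm] at h
    linarith
  · rintro f hf y ⟨m, hm, hym⟩
    obtain ⟨k, hk, h⟩ := hsym f hf (m ∘ π) (by rw [← hm]; exact Equiv.sum_comp π m)
    refine ⟨v k, ⟨k, by simp; omega, rfl⟩, ?_⟩
    have e := hy y m hym
    simp only [Function.comp] at h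
    rw [← hv, ← e, hf.2.2.2.1, hf.2.2.2.1] at h
    have hfy : 0 ≤ f y := hf.nonneg fun i => by
      rw [hym]; exact mul_nonneg (Nat.cast_nonneg _) (hp i).le
    refine h.trans (mul_le_mul_of_nonneg_right ?_ hfy)
    nlinarith
end

section
/- There exists a constant c > 0 such that for every real α ≥ 2 there are infinitely many d for which there is an MLIJ instance on d machines (a choice of processing times p_1,…,p_d > 0 and number of jobs n ≥ 1) whose feasible set D has the property that every subset X ⊆ D that is an α-approximate portfolio for the class of all ordered norms over D satisfies |X| ≥ c·log d / (log α + log log d). -/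
theorem sum_absSortDesc {d : ℕ} (x : Fin d → ℝ) : ∑ k, absSortDesc x k = ∑ i, |x i| := by
  unfold absSortDesc
  rw [← Equiv.sum_comp (Tuple.sort fun i => |x i|) (fun i => |x i|),
    ← Equiv.sum_comp Fin.revPerm (fun k => |x (Tuple.sort (fun i => |x i|) k)|)]
  rfl

theorem abs_le_absSortDesc_zero {d : ℕ} (hd : 0 < d) (x : Fin d → ℝ) (i : Fin d) :
    |x i| ≤ absSortDesc x ⟨0, hd⟩ := by
  have h := Tuple.monotone_sort (fun i => |x i|)
  have hle : (Tuple.sort fun i => |x i|).symm i ≤ (⟨0, hd⟩ : Fin d).rev := by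
    rw [Fin.le_def, Fin.val_rev]
    have := ((Tuple.sort fun i => |x i|).symm i).isLt
    simp only
    omega
  simpa [absSortDesc] using h hle

/-- The weight vector `(T + 1, 1, …, 1)`, whose ordered norm is `T ‖x‖_∞ + ‖x‖_1`. -/
def maxSumWeight (d : ℕ) (T : ℝ) : Fin d → ℝ :=
  fun k => (if (k : ℕ) = 0 then T else 0) + 1

theorem isWeightVector_maxSumWeight {d : ℕ} (hd : 0 < d) {T : ℝ} (hT : 0 ≤ T) :
    IsWeightVector (maxSumWeight d T) := by
  refine ⟨fun a b hab => ?_, fun k => ?_, fun h => ?_⟩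
  · have hab' : (a : ℕ) ≤ b := hab
    unfold maxSumWeight
    split_ifs with h1 h2
    · exact le_rfl
    · omega
    · linarith
    · exact le_rfl
  · unfold maxSumWeight
    split_ifs <;> linarith
  · have := congrFun h ⟨0, hd⟩
    simp only [maxSumWeight, if_true, Pi.zero_apply] at this
    linarith

theorem orderedNorm_maxSumWeight {d : ℕ} (hd : 0 < d) (T : ℝ) (x : Fin d → ℝ) :
    orderedNorm (maxSumWeight d T) x = T * absSortDesc x ⟨0, hd⟩ + ∑ i, |x i| := by
  have h0 : ∀ k : Fin d, (k : ℕ) = 0 ↔ k = ⟨0, hd⟩ := fun k => by simp [Fin.ext_iff]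
  simp [orderedNorm, maxSumWeight, add_mul, Finset.sum_add_distrib, sum_absSortDesc, h0]

theorem finite_MLIJ {d : ℕ} (p : Fin d → ℝ) (n : ℕ) : (MLIJ p n).Finite := by
  refine ((Set.finite_Icc (0 : Fin d → ℕ) (fun _ => n)).image
    (fun m i => (m i : ℝ) * p i)).subset ?_
  rintro x ⟨m, hm, hx⟩
  refine ⟨m, ⟨fun i => Nat.zero_le _, fun i => ?_⟩, (funext hx).symm⟩
  rw [← hm]
  exact Finset.single_le_sum (fun j _ => Nat.zero_le (m j)) (Finset.mem_univ i)

theorem sum_range_inv_sqrt_le (k : ℕ) :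
    ∑ i ∈ Finset.range k, 1 / √((i : ℝ) + 1) ≤ 2 * √(k : ℝ) := by
  induction k with
  | zero => simp
  | succ k ih =>
    rw [Finset.sum_range_succ]
    push_cast
    have hb : 0 < √((k : ℝ) + 1) := Real.sqrt_pos.2 (by positivity)
    have ha : 0 ≤ √(k : ℝ) := Real.sqrt_nonneg _
    have hb2 : √((k : ℝ) + 1) ^ 2 = k + 1 := Real.sq_sqrt (by positivity)
    have ha2 : √(k : ℝ) ^ 2 = k := Real.sq_sqrt (by positivity)
    have key : 1 / √((k : ℝ) + 1) ≤ 2 * √((k : ℝ) + 1) - 2 * √(k : ℝ) := by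
      rw [div_le_iff₀ hb]
      nlinarith [sq_nonneg (√((k : ℝ) + 1) - √(k : ℝ))]
    linarith

/-- With processing times `√(i + 1)`, small makespan `M` forces a large total load. -/
theorem card_jobs_le {d n : ℕ} {x : Fin d → ℝ}
    (hx : x ∈ MLIJ (fun i : Fin d => √((i : ℝ) + 1)) n) {M : ℝ} (hM : ∀ i, |x i| ≤ M)
    (hM0 : 0 ≤ M) {K : ℕ} (hK : 0 < K) :
    (n : ℝ) ≤ 2 * K * M + (∑ i, |x i|) / K := by
  obtain ⟨m, hm, hx⟩ := hx
  have hKr : (0 : ℝ) < K := by exact_mod_cast hK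
  have hterm : ∀ i : Fin d, (m i : ℝ) ≤
      (if (i : ℕ) < K ^ 2 then M * (1 / √((i : ℝ) + 1)) else 0) + |x i| / K := by
    intro i
    have hp : 0 < √((i : ℝ) + 1) := Real.sqrt_pos.2 (by positivity)
    have hxi : |x i| = m i * √((i : ℝ) + 1) := by
      rw [hx i, abs_of_nonneg (by positivity)]
    split_ifs with h
    · have h1 : (m i : ℝ) ≤ M * (1 / √((i : ℝ) + 1)) := by
        rw [mul_one_div, le_div_iff₀ hp, ← hxi]
        exact hM i
      have : 0 ≤ |x i| / K := by positivity
      linarith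
    · rw [zero_add, le_div_iff₀ hKr, hxi]
      refine mul_le_mul_of_nonneg_left (Real.le_sqrt_of_sq_le ?_) (Nat.cast_nonneg _)
      have : ((K ^ 2 : ℕ) : ℝ) ≤ (i : ℕ) := by exact_mod_cast not_lt.1 h
      push_cast at this
      linarith
  have hsum : ∑ i : Fin d, (if (i : ℕ) < K ^ 2 then M * (1 / √((i : ℝ) + 1)) else 0)
      ≤ M * (2 * K) := by
    rw [Fin.sum_univ_eq_sum_range
      (fun i => if i < K ^ 2 then M * (1 / √((i : ℝ) + 1)) else 0) d, ← Finset.sum_filter,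
      ← Finset.mul_sum]
    refine mul_le_mul_of_nonneg_left ?_ hM0
    calc _ ≤ ∑ i ∈ Finset.range (K ^ 2), 1 / √((i : ℝ) + 1) := by
          refine Finset.sum_le_sum_of_subset_of_nonneg (fun i hi => ?_) fun i _ _ => by positivity
          simpa using (Finset.mem_filter.1 hi).2
      _ ≤ 2 * √((K ^ 2 : ℕ) : ℝ) := sum_range_inv_sqrt_le _
      _ = 2 * K := by rw [Nat.cast_pow, Real.sqrt_sq hKr.le]
  calc (n : ℝ) = ∑ i, (m i : ℝ) := by rw [← hm]; push_cast; rfl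
    _ ≤ _ := Finset.sum_le_sum fun i _ => hterm i
    _ ≤ M * (2 * K) + (∑ i, |x i|) / K := by
      rw [Finset.sum_add_distrib, Finset.sum_div]
      linarith
    _ = _ := by ring

/-- Spreading the jobs evenly over the first `S ^ (2 m)` machines is good for the `m`-th norm. -/
theorem exists_mem_MLIJ_orderedNorm_le {S N m : ℕ} (hS : 0 < S) (hm : m ≤ N) :
    ∃ y ∈ MLIJ (fun i : Fin (S ^ (2 * N)) => √((i : ℝ) + 1)) (S ^ (2 * N)),
      orderedNorm (maxSumWeight (S ^ (2 * N)) ((S : ℝ) ^ (2 * m))) y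
        ≤ 2 * (S : ℝ) ^ (2 * N) * (S : ℝ) ^ m := by
  have hd : 0 < S ^ (2 * N) := by positivity
  have hSr : (0 : ℝ) < S := by exact_mod_cast hS
  have hle : S ^ (2 * m) ≤ S ^ (2 * N) := Nat.pow_le_pow_right hS (by omega)
  have hcount : ∀ c : ℝ, ∑ i : Fin (S ^ (2 * N)), (if (i : ℕ) < S ^ (2 * m) then c else 0)
      = (S : ℝ) ^ (2 * m) * c := by
    intro c
    rw [Fin.sum_univ_eq_sum_range (fun i => if i < S ^ (2 * m) then c else 0), ← Finset.sum_filter]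
    have : (Finset.range (S ^ (2 * N))).filter (· < S ^ (2 * m)) = Finset.range (S ^ (2 * m)) := by
      ext i
      simp only [Finset.mem_filter, Finset.mem_range]
      omega
    rw [this]
    simp
  let a : Fin (S ^ (2 * N)) → ℕ := fun i => if (i : ℕ) < S ^ (2 * m) then S ^ (2 * N - 2 * m) else 0
  have hpow : (S : ℝ) ^ (2 * m) * (S : ℝ) ^ (2 * N - 2 * m) = (S : ℝ) ^ (2 * N) := by
    rw [← pow_add]
    congr 1
    omega
  refine ⟨fun i => a i * √((i : ℝ) + 1), ⟨a, ?_, fun i => rfl⟩, ?_⟩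
  · have h := hcount ((S : ℝ) ^ (2 * N - 2 * m))
    rw [hpow] at h
    have : ((∑ i, a i : ℕ) : ℝ) = ((S ^ (2 * N) : ℕ) : ℝ) := by
      push_cast
      rw [← h]
      refine Finset.sum_congr rfl fun i _ => ?_
      simp only [a]
      split_ifs <;> simp
    exact_mod_cast this
  · have habs : ∀ i, |(a i : ℝ) * √((i : ℝ) + 1)| ≤
        if (i : ℕ) < S ^ (2 * m) then (S : ℝ) ^ (2 * N - 2 * m) * (S : ℝ) ^ m else 0 := by
      intro i
      rw [abs_of_nonneg (by positivity)]
      simp only [a]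
      split_ifs with h
      · push_cast
        refine mul_le_mul_of_nonneg_left ?_ (by positivity)
        refine Real.sqrt_le_iff.2 ⟨by positivity, ?_⟩
        rw [← pow_mul, mul_comm m 2]
        exact_mod_cast h
      · simp
    rw [orderedNorm_maxSumWeight hd]
    have h1 : absSortDesc (fun i => (a i : ℝ) * √((i : ℝ) + 1)) ⟨0, hd⟩ ≤
        (S : ℝ) ^ (2 * N - 2 * m) * (S : ℝ) ^ m := by
      refine (habs _).trans ?_
      split_ifs
      · exact le_rfl
      · positivity
    have h2 := Finset.sum_le_sum fun i (_ : i ∈ Finset.univ) => habs i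
    rw [hcount] at h2
    have h3 := mul_le_mul_of_nonneg_left h1 (by positivity : (0 : ℝ) ≤ (S : ℝ) ^ (2 * m))
    rw [← mul_assoc, hpow] at h2 h3
    linarith

/-- No solution is an `α`-approximation for two of the norms at once. -/
theorem not_orderedNorm_le_of_lt {S B N n m m' : ℕ} {α : ℝ} {x : Fin (S ^ (2 * N)) → ℝ}
    (hα : 0 < α) (hB : 8 * α ≤ B) (hS : S = 2 * B ^ 2) (hn : 0 < n) (hmm : m < m')
    (hx : x ∈ MLIJ (fun i : Fin (S ^ (2 * N)) => √((i : ℝ) + 1)) n)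
    (h : orderedNorm (maxSumWeight _ ((S : ℝ) ^ (2 * m))) x ≤ α * (2 * n * (S : ℝ) ^ m)) :
    ¬ orderedNorm (maxSumWeight _ ((S : ℝ) ^ (2 * m'))) x ≤ α * (2 * n * (S : ℝ) ^ m') := by
  intro h'
  have hBr : (0 : ℝ) < B := by linarith
  have hBn : 0 < B := by exact_mod_cast hBr
  have hSn : 0 < S := by rw [hS]; positivity
  have hSr : (0 : ℝ) < S := by exact_mod_cast hSn
  have hnr : (0 : ℝ) < n := by exact_mod_cast hn
  have hd : 0 < S ^ (2 * N) := by positivity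
  rw [orderedNorm_maxSumWeight hd] at h h'
  set M := absSortDesc x ⟨0, hd⟩ with hMdef
  set L := ∑ i, |x i| with hLdef
  have hM0 : 0 ≤ M := abs_nonneg _
  have hL0 : 0 ≤ L := Finset.sum_nonneg fun i _ => abs_nonneg _
  have hcard := card_jobs_le hx (abs_le_absSortDesc_zero hd x) hM0
    (K := B * S ^ m) (by positivity)
  rw [← hMdef, ← hLdef] at hcard
  push_cast at hcard
  have hL : L / (B * (S : ℝ) ^ m) ≤ n / 4 := by
    rw [div_le_iff₀ (by positivity)]
    have h1 : L ≤ α * (2 * n * (S : ℝ) ^ m) :=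
      (le_add_of_nonneg_left (by positivity)).trans h
    have h2 : 8 * α * (n * (S : ℝ) ^ m) ≤ B * (n * (S : ℝ) ^ m) :=
      mul_le_mul_of_nonneg_right hB (by positivity)
    linarith
  have hM : (S : ℝ) ^ m' * M ≤ 2 * α * n := by
    have h1 : (S : ℝ) ^ (2 * m') * M ≤ α * (2 * n * (S : ℝ) ^ m') :=
      (le_add_of_nonneg_right hL0).trans h'
    rw [two_mul, pow_add] at h1
    refine le_of_mul_le_mul_left ?_ (by positivity : (0 : ℝ) < (S : ℝ) ^ m')
    linarith
  have hM' : 2 * (B : ℝ) ^ 2 * (S : ℝ) ^ m * M ≤ 2 * α * n := by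
    refine le_trans (mul_le_mul_of_nonneg_right ?_ hM0) hM
    have hSB : (S : ℝ) = 2 * (B : ℝ) ^ 2 := by rw [hS]; push_cast; rfl
    rw [← hSB, ← pow_succ']
    exact pow_le_pow_right₀ (by exact_mod_cast hSn) hmm
  have hM'' : 2 * (B * (S : ℝ) ^ m) * M ≤ n / 4 := by
    refine le_of_mul_le_mul_left ?_ hBr
    have : 8 * α * n ≤ B * n := mul_le_mul_of_nonneg_right hB hnr.le
    nlinarith
  linarith

/-- Every portfolio contains at least one solution for each of the `N + 1` norms. -/
theorem succ_le_ncard_portfolio {S B N : ℕ} {α : ℝ} (hα : 0 < α) (hB : 8 * α ≤ B)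
    (hS : S = 2 * B ^ 2) {X : Set (Fin (S ^ (2 * N)) → ℝ)}
    (hX : X ⊆ MLIJ (fun i : Fin (S ^ (2 * N)) => √((i : ℝ) + 1)) (S ^ (2 * N)))
    (happrox : ∀ w : Fin (S ^ (2 * N)) → ℝ, IsWeightVector w →
      ∀ y ∈ MLIJ (fun i : Fin (S ^ (2 * N)) => √((i : ℝ) + 1)) (S ^ (2 * N)),
        ∃ x ∈ X, orderedNorm w x ≤ α * orderedNorm w y) :
    N + 1 ≤ X.ncard := by
  have hBn : 0 < B := by
    have : (0 : ℝ) < B := by linarith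
    exact_mod_cast this
  have hSn : 0 < S := by rw [hS]; positivity
  have hd : 0 < S ^ (2 * N) := by positivity
  have hex : ∀ m : Fin (N + 1), ∃ x ∈ X,
      orderedNorm (maxSumWeight _ ((S : ℝ) ^ (2 * (m : ℕ)))) x ≤
        α * (2 * (S ^ (2 * N) : ℕ) * (S : ℝ) ^ (m : ℕ)) := by
    intro m
    obtain ⟨y, hy, hyle⟩ := exists_mem_MLIJ_orderedNorm_le hSn (Nat.lt_succ_iff.1 m.isLt)
    obtain ⟨x, hxX, hxle⟩ := happrox _
      (isWeightVector_maxSumWeight hd (by positivity : (0 : ℝ) ≤ (S : ℝ) ^ (2 * (m : ℕ)))) y hy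
    refine ⟨x, hxX, hxle.trans (mul_le_mul_of_nonneg_left ?_ hα.le)⟩
    push_cast
    exact hyle
  choose f hfX hf using hex
  have hinj : Function.Injective f := by
    refine Function.Injective.of_lt_imp_ne fun a b hab heq => ?_
    refine not_orderedNorm_le_of_lt hα hB hS hd hab (hX (hfX a)) (hf a) ?_
    rw [heq]
    exact hf b
  have hcard := Set.ncard_le_ncard (Set.range_subset_iff.2 hfX) ((finite_MLIJ _ _).subset hX)
  rwa [← Set.image_univ, Set.ncard_image_of_injective _ hinj, Set.ncard_univ, Nat.card_fin]
    at hcard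

/-- Theorem 1 (lower bound): portfolio-size lower bound for MLIJ and ordered norms. -/
theorem stmt1 :
    ∃ c : ℝ, 0 < c ∧
      ∀ α : ℝ, 2 ≤ α →
      ∀ d₀ : ℕ, ∃ d : ℕ, d₀ ≤ d ∧
        ∃ (p : Fin d → ℝ) (n : ℕ), (∀ i, 0 < p i) ∧ 1 ≤ n ∧
          ∀ X : Set (Fin d → ℝ), X ⊆ MLIJ p n →
            (∀ w : Fin d → ℝ, IsWeightVector w →
              ∀ y ∈ MLIJ p n, ∃ x ∈ X, orderedNorm w x ≤ α * orderedNorm w y) →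
            c * Real.log d / (Real.log α + Real.log (Real.log d)) ≤ (X.ncard : ℝ) := by
  refine ⟨1 / 22, by norm_num, fun α hα d₀ => ?_⟩
  obtain ⟨A, hA, hA'⟩ : ∃ A : ℕ, α ≤ A ∧ (A : ℝ) ≤ 3 / 2 * α :=
    ⟨⌈α⌉₊, Nat.le_ceil α, by linarith [Nat.ceil_lt_add_one (by linarith : 0 ≤ α)]⟩
  obtain ⟨S, hS⟩ : ∃ S : ℕ, S = 2 * (8 * A) ^ 2 := ⟨_, rfl⟩
  have hSr : (S : ℝ) = 128 * (A : ℝ) ^ 2 := by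
    rw [hS]
    push_cast
    ring
  have hS128 : (128 : ℝ) ≤ S := by nlinarith
  have hS128' : 128 ≤ S := by exact_mod_cast hS128
  have hlogα : 0 < Real.log α := Real.log_pos (by linarith)
  have hlogS : Real.log S ≤ 11 * Real.log α := by
    rw [show (11 : ℝ) * Real.log α = Real.log (α ^ 11) by rw [Real.log_pow]; norm_num]
    refine Real.log_le_log (by linarith) ?_
    have h9 : (2 : ℝ) ^ 9 ≤ α ^ 9 := pow_le_pow_left₀ (by norm_num) hα 9
    have h2 : (A : ℝ) ^ 2 ≤ (3 / 2 * α) ^ 2 := pow_le_pow_left₀ (by linarith) hA' 2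
    have h11 : (2 : ℝ) ^ 9 * α ^ 2 ≤ α ^ 9 * α ^ 2 :=
      mul_le_mul_of_nonneg_right h9 (by positivity)
    rw [hSr]
    nlinarith [sq_nonneg α]
  have hlogd : Real.log ((S ^ (2 * (d₀ + 1)) : ℕ) : ℝ) = 2 * (d₀ + 1) * Real.log S := by
    rw [Nat.cast_pow, Real.log_pow]
    push_cast
    ring
  have hlogS1 : 1 ≤ Real.log S := by
    rw [Real.le_log_iff_exp_le (by linarith)]
    linarith [Real.exp_one_lt_d9]
  have hd₀ : (0 : ℝ) ≤ d₀ := Nat.cast_nonneg _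
  refine ⟨S ^ (2 * (d₀ + 1)), ?_, fun i => √((i : ℝ) + 1), S ^ (2 * (d₀ + 1)),
    fun i => Real.sqrt_pos.2 (by positivity), Nat.one_le_pow _ _ (by omega),
    fun X hX happrox => ?_⟩
  · exact le_trans (by omega) (Nat.lt_pow_self (n := 2 * (d₀ + 1)) (by omega : 1 < S)).le
  · have hcard := succ_le_ncard_portfolio (B := 8 * A) (by linarith : 0 < α)
      (by push_cast; linarith) hS hX happrox
    have hcard' : (d₀ : ℝ) + 1 + 1 ≤ X.ncard := by exact_mod_cast hcard
    have hloglog : 0 ≤ Real.log (Real.log ((S ^ (2 * (d₀ + 1)) : ℕ) : ℝ)) := by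
      refine Real.log_nonneg ?_
      rw [hlogd]
      nlinarith
    rw [div_le_iff₀ (by linarith)]
    calc 1 / 22 * Real.log ((S ^ (2 * (d₀ + 1)) : ℕ) : ℝ)
        = (d₀ + 1) * (Real.log S / 11) := by rw [hlogd]; ring
      _ ≤ X.ncard * _ :=
        mul_le_mul (by linarith) (by linarith) (by linarith) (Nat.cast_nonneg _)
end

section
/- There exist constants c > 0 and c' > 0 such that for all sufficiently large d there is a nonempty finite set D ⊆ ℝ_{≥0}^d with the following property: every subset X ⊆ D satisfying min_{x∈X} ‖x‖_(w) ≤ c·(log d)·min_{x∈D} ‖x‖_(w) for every ordered norm ‖·‖_(w) on ℝ^d must have cardinality |X| ≥ d^{c'/log log d}. -/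
theorem absSortDesc_eq_self {d : ℕ} {x : Fin d → ℝ} (hx : Antitone x) (h0 : ∀ i, 0 ≤ x i) :
    absSortDesc x = x := by
  have habs : (fun i => |x i|) = x := funext fun i => abs_of_nonneg (h0 i)
  have hrev : Monotone (x ∘ Fin.revPerm) := fun i j hij => hx (Fin.rev_le_rev.mpr hij)
  have h := Tuple.unique_monotone (Tuple.monotone_sort x) hrev
  funext k
  have hk := congrFun h k.rev
  simp only [Function.comp_apply, Fin.revPerm_apply, Fin.rev_rev] at hk
  simp only [absSortDesc, habs, hk, abs_of_nonneg (h0 k)]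

theorem sum_Ico_one_pow_log {B : ℕ} (hB : 1 < B) (G : ℕ → ℝ) (L : ℕ) :
    ∑ n ∈ Finset.Ico 1 (B ^ L), G (Nat.log B n) =
      ∑ i ∈ Finset.range L, ((B : ℝ) ^ (i + 1) - (B : ℝ) ^ i) * G i := by
  induction L with
  | zero => simp
  | succ L ih =>
    have hle : B ^ L ≤ B ^ (L + 1) := Nat.pow_le_pow_right (by omega) (by omega)
    rw [Finset.sum_range_succ, ← ih,
      ← Finset.sum_Ico_consecutive _ (Nat.one_le_pow L B (by omega)) hle]
    congr 1
    have hconst : ∀ n ∈ Finset.Ico (B ^ L) (B ^ (L + 1)), G (Nat.log B n) = G L := by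
      intro n hn
      rw [Finset.mem_Ico] at hn
      rw [Nat.log_eq_of_pow_le_of_lt_pow hn.1 hn.2]
    rw [Finset.sum_congr rfl hconst, Finset.sum_const, Nat.card_Ico, nsmul_eq_mul,
      Nat.cast_sub hle]
    push_cast
    rfl

/-- The factor by which the `i`-th block of coordinates is scaled: `b` on `A`, and `1` off `A`. -/
def blockFactor (b : ℕ) (A : Finset ℕ) (i : ℕ) : ℝ := if i ∈ A then (b : ℝ) else 1

/-- The value on the `i`-th block of coordinates; only the first `L` blocks are nonzero. -/
noncomputable def blockValue (b L : ℕ) (A : Finset ℕ) (i : ℕ) : ℝ :=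
  if i < L then blockFactor b A i / (b : ℝ) ^ i else 0

/-- The vector that equals `blockValue b L A i` at the `k`-th coordinate (counted from `1`)
whenever `(b ^ 2) ^ i ≤ k < (b ^ 2) ^ (i + 1)`. -/
noncomputable def blockVec (d b L : ℕ) (A : Finset ℕ) (k : Fin d) : ℝ :=
  blockValue b L A (Nat.log (b ^ 2) (k + 1))

section blockVec

variable {d b L : ℕ}

theorem one_le_blockFactor (hb : 2 ≤ b) (A : Finset ℕ) (i : ℕ) : 1 ≤ blockFactor b A i := by
  unfold blockFactor
  split_ifs
  · exact_mod_cast (by omega : 1 ≤ b)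
  · exact le_rfl

theorem blockFactor_le (hb : 2 ≤ b) (A : Finset ℕ) (i : ℕ) : blockFactor b A i ≤ b := by
  unfold blockFactor
  split_ifs
  · exact le_rfl
  · exact_mod_cast (by omega : 1 ≤ b)

theorem blockValue_nonneg (hb : 2 ≤ b) (A : Finset ℕ) (i : ℕ) : 0 ≤ blockValue b L A i := by
  have := one_le_blockFactor hb A i
  unfold blockValue
  split_ifs <;> positivity

theorem antitone_blockValue (hb : 2 ≤ b) (A : Finset ℕ) : Antitone (blockValue b L A) := by
  refine antitone_nat_of_succ_le fun i => ?_
  by_cases hi : i + 1 < L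
  · have hb0 : (0 : ℝ) < b := by exact_mod_cast (by omega : 0 < b)
    rw [blockValue, blockValue, if_pos hi, if_pos (by omega), pow_succ, mul_comm, ← div_div]
    gcongr
    rw [div_le_iff₀ hb0]
    nlinarith [one_le_blockFactor hb A i, blockFactor_le hb A (i + 1)]
  · rw [blockValue, if_neg hi]
    exact blockValue_nonneg hb A i

theorem blockVec_nonneg (hb : 2 ≤ b) (A : Finset ℕ) (k : Fin d) : 0 ≤ blockVec d b L A k :=
  blockValue_nonneg hb A _

theorem antitone_blockVec (hb : 2 ≤ b) (A : Finset ℕ) : Antitone (blockVec d b L A) :=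
  fun _ _ hij => antitone_blockValue hb A (Nat.log_mono_right (by simpa using hij))

theorem isWeightVector_blockVec (hb : 2 ≤ b) (hL : 0 < L) (hd : 0 < d) (A : Finset ℕ) :
    IsWeightVector (blockVec d b L A) := by
  refine ⟨antitone_blockVec hb A, blockVec_nonneg hb A, fun h => ?_⟩
  have h0 := congrFun h ⟨0, hd⟩
  have := one_le_blockFactor hb A 0
  simp [blockVec, blockValue, hL] at h0
  linarith

theorem orderedNorm_blockVec (hb : 2 ≤ b) (hd : (b ^ 2) ^ L ≤ d) (A A' : Finset ℕ) :
    orderedNorm (blockVec d b L A) (blockVec d b L A') =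
      ((b : ℝ) ^ 2 - 1) *
        ∑ i ∈ Finset.range L, blockFactor b A i * blockFactor b A' i := by
  have hB : 1 < b ^ 2 := by nlinarith
  have hb0 : (b : ℝ) ≠ 0 := by exact_mod_cast (by omega : b ≠ 0)
  set G : ℕ → ℝ := fun i => blockValue b L A i * blockValue b L A' i with hG
  unfold orderedNorm
  rw [absSortDesc_eq_self (antitone_blockVec hb A') (blockVec_nonneg hb A')]
  calc ∑ k, blockVec d b L A k * blockVec d b L A' k
      = ∑ n ∈ Finset.range d, G (Nat.log (b ^ 2) (n + 1)) :=
        Fin.sum_univ_eq_sum_range (fun n => G (Nat.log (b ^ 2) (n + 1))) d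
    _ = ∑ n ∈ Finset.Ico 1 (d + 1), G (Nat.log (b ^ 2) n) := by
        rw [Finset.sum_Ico_eq_sum_range]
        simp [add_comm]
    _ = ∑ n ∈ Finset.Ico 1 ((b ^ 2) ^ L), G (Nat.log (b ^ 2) n) := by
        symm
        refine Finset.sum_subset (Finset.Ico_subset_Ico_right (by omega)) fun n hn hn' => ?_
        rw [Finset.mem_Ico] at hn hn'
        have hlog : ¬ Nat.log (b ^ 2) n < L :=
          not_lt.mpr (Nat.le_log_of_pow_le hB (by omega))
        simp only [hG, blockValue, if_neg hlog, mul_zero]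
    _ = _ := by
        rw [sum_Ico_one_pow_log hB, Finset.mul_sum]
        refine Finset.sum_congr rfl fun i hi => ?_
        simp only [hG, blockValue, if_pos (Finset.mem_range.mp hi)]
        push_cast
        field_simp
        ring

theorem orderedNorm_blockVec_compl (hb : 2 ≤ b) (hd : (b ^ 2) ^ L ≤ d) (A : Finset ℕ) :
    orderedNorm (blockVec d b L (Finset.range L \ A)) (blockVec d b L A) =
      ((b : ℝ) ^ 2 - 1) * (L * b) := by
  rw [orderedNorm_blockVec hb hd]
  have hconst : ∀ i ∈ Finset.range L,
      blockFactor b (Finset.range L \ A) i * blockFactor b A i = b := by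
    intro i hi
    by_cases hA : i ∈ A <;> simp_all [blockFactor]
  rw [Finset.sum_congr rfl hconst, Finset.sum_const, Finset.card_range, nsmul_eq_mul]

theorem le_orderedNorm_blockVec_compl (hb : 2 ≤ b) (hd : (b ^ 2) ^ L ≤ d) {A T : Finset ℕ}
    (hT : T ⊆ Finset.range L) (hTA : ¬ T ⊆ A) :
    ((b : ℝ) ^ 2 - 1) * (b : ℝ) ^ 2 ≤
      orderedNorm (blockVec d b L (Finset.range L \ A)) (blockVec d b L T) := by
  obtain ⟨i, hiT, hiA⟩ := Finset.not_subset.mp hTA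
  have hb1 : (2 : ℝ) ≤ b := by exact_mod_cast hb
  rw [orderedNorm_blockVec hb hd]
  refine mul_le_mul_of_nonneg_left ?_ (by nlinarith)
  calc (b : ℝ) ^ 2
      = blockFactor b (Finset.range L \ A) i * blockFactor b T i := by
        have hiL := Finset.mem_range.mp (hT hiT)
        simp [blockFactor, hiT, hiA, hiL, sq]
    _ ≤ _ := Finset.single_le_sum
        (f := fun i => blockFactor b (Finset.range L \ A) i * blockFactor b T i)
        (fun j _ => mul_nonneg (zero_le_one.trans (one_le_blockFactor hb _ j))
          (zero_le_one.trans (one_le_blockFactor hb _ j))) (hT hiT)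

end blockVec

theorem two_pow_le_centralBinom {M : ℕ} (hM : 0 < M) : 2 ^ M ≤ Nat.centralBinom M := by
  have h := Nat.four_pow_le_two_mul_self_mul_centralBinom M hM
  have h2 : 2 * M ≤ 2 ^ M := by
    obtain ⟨m, rfl⟩ := Nat.exists_eq_succ_of_ne_zero hM.ne'
    have := Nat.lt_two_pow_self (n := m)
    rw [pow_succ]
    omega
  have h4 : 4 ^ M = 2 ^ M * 2 ^ M := by rw [← mul_pow]; norm_num
  rw [h4] at h
  exact le_of_mul_le_mul_left (h.trans (Nat.mul_le_mul_right _ h2)) (by positivity)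

/-- If `α` is smaller than `b / (2 * M)`, then `α`-approximate portfolios for ordered norms may
need `Nat.centralBinom M` vectors. -/
theorem exists_portfolio_lower_bound {d b M : ℕ} {α : ℝ} (hb : 2 ≤ b) (hM : 0 < M)
    (hd : (b ^ 2) ^ (2 * M) ≤ d) (hα : 1 ≤ α) (hαb : α * (2 * M) < b) :
    ∃ D : Set (Fin d → ℝ), D.Nonempty ∧ D.Finite ∧ (∀ x ∈ D, ∀ i, 0 ≤ x i) ∧
      ∀ X : Set (Fin d → ℝ), X ⊆ D →
        (∀ w : Fin d → ℝ, IsWeightVector w →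
          ∀ y ∈ D, ∃ x ∈ X, orderedNorm w x ≤ α * orderedNorm w y) →
        Nat.centralBinom M ≤ X.ncard := by
  set L := 2 * M with hL
  set P := Finset.powersetCard M (Finset.range L) with hP
  have hb2 : (2 : ℝ) ≤ b := by exact_mod_cast hb
  have hd0 : 0 < d := lt_of_lt_of_le (by positivity) hd
  have eq_of_le : ∀ A ∈ P, ∀ T ∈ P,
      orderedNorm (blockVec d b L (Finset.range L \ A)) (blockVec d b L T) ≤
        α * orderedNorm (blockVec d b L (Finset.range L \ A)) (blockVec d b L A) → T = A := by
    intro A hA T hT h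
    rw [hP, Finset.mem_powersetCard] at hA hT
    by_contra hne
    have hTA : ¬ T ⊆ A := fun hsub => hne (Finset.eq_of_subset_of_card_le hsub (by omega))
    have h1 := (le_orderedNorm_blockVec_compl hb hd hT.1 hTA).trans h
    rw [orderedNorm_blockVec_compl hb hd] at h1
    have h2 : α * (L * b) < (b : ℝ) ^ 2 := by
      rw [hL]
      push_cast
      nlinarith
    have h3 : (0 : ℝ) < (b : ℝ) ^ 2 - 1 := by nlinarith
    rw [mul_left_comm] at h1
    exact absurd (le_of_mul_le_mul_left h1 h3) (not_le.mpr h2)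
  have norm_nonneg : ∀ A, 0 ≤
      orderedNorm (blockVec d b L (Finset.range L \ A)) (blockVec d b L A) := by
    intro A
    rw [orderedNorm_blockVec_compl hb hd]
    have : (0 : ℝ) ≤ (b : ℝ) ^ 2 - 1 := by nlinarith
    positivity
  have hinj : Set.InjOn (blockVec d b L) P := by
    intro T hT A hA h
    refine eq_of_le A hA T hT ?_
    rw [h]
    exact le_mul_of_one_le_left (norm_nonneg A) hα
  have hcard : (P : Set (Finset ℕ)).ncard = Nat.centralBinom M := by
    rw [Set.ncard_coe_finset, hP, Finset.card_powersetCard, Finset.card_range, hL,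
      Nat.centralBinom]
  have hfin : (blockVec d b L '' (P : Set (Finset ℕ))).Finite := P.finite_toSet.image _
  refine ⟨blockVec d b L '' P, ?_, hfin, ?_, fun X hXD hX => ?_⟩
  · refine Set.Nonempty.image _ (Finset.coe_nonempty.mpr ?_)
    rw [hP, Finset.powersetCard_nonempty, Finset.card_range]
    omega
  · rintro _ ⟨A, -, rfl⟩ i
    exact blockVec_nonneg hb A i
  · rw [← hcard, ← hinj.ncard_image]
    refine Set.ncard_le_ncard ?_ (hfin.subset hXD)
    rintro _ ⟨A, hA, rfl⟩
    obtain ⟨x, hx, hle⟩ := hX _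
      (isWeightVector_blockVec (L := L) hb (by omega) hd0 (Finset.range L \ A)) _ ⟨A, hA, rfl⟩
    obtain ⟨T, hT, rfl⟩ := hXD hx
    rwa [← eq_of_le A hA T hT hle]

/-- Theorem: near-polynomial lower bound on portfolio sizes for ordered norms,
even with approximation factor `c · log d`. -/
theorem stmt4 :
    ∃ c c' : ℝ, 0 < c ∧ 0 < c' ∧
      ∃ d₀ : ℕ, ∀ d : ℕ, d₀ ≤ d →
        ∃ D : Set (Fin d → ℝ), D.Nonempty ∧ D.Finite ∧ (∀ x ∈ D, ∀ i, 0 ≤ x i) ∧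
          ∀ X : Set (Fin d → ℝ), X ⊆ D →
            (∀ w : Fin d → ℝ, IsWeightVector w →
              ∀ y ∈ D, ∃ x ∈ X, orderedNorm w x ≤ c * Real.log d * orderedNorm w y) →
            (d : ℝ) ^ (c' / Real.log (Real.log d)) ≤ (X.ncard : ℝ) := by
  refine ⟨1, 1 / 64, one_pos, by norm_num, ?_⟩
  have hlog : Filter.Tendsto (fun d : ℕ => Real.log d) Filter.atTop Filter.atTop :=
    Real.tendsto_log_atTop.comp tendsto_natCast_atTop_atTop
  have hlittle := Real.isLittleO_log_id_atTop.bound (show (0 : ℝ) < 1 / 16 by norm_num)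
  have hloglog := Real.tendsto_log_atTop.eventually_ge_atTop 1
  obtain ⟨d₀, hd₀⟩ := Filter.eventually_atTop.mp
    (hlog.eventually ((hlittle.and hloglog).and (Filter.eventually_ge_atTop 2)))
  refine ⟨d₀, fun d hd => ?_⟩
  obtain ⟨⟨hsmall, hll⟩, hl⟩ := hd₀ d hd
  set l := Real.log d with hldef
  rw [id, Real.norm_of_nonneg (by linarith), Real.norm_of_nonneg (by linarith)] at hsmall
  have hd0 : (0 : ℝ) < d := by
    rcases Nat.eq_zero_or_pos d with rfl | h
    · norm_num [hldef] at hl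
    · exact_mod_cast h
  set q := l / Real.log l with hq
  have hq16 : 16 ≤ q := by
    rw [hq, le_div_iff₀ (by linarith)]
    linarith
  have hql : q * Real.log l = l := div_mul_cancel₀ _ (by linarith)
  have hqle : q ≤ l := div_le_self (by linarith) hll
  set M := ⌊q / 16⌋₊ with hMdef
  have hMle : (M : ℝ) ≤ q / 16 := Nat.floor_le (by linarith)
  have hMlt : q / 16 < M + 1 := Nat.lt_floor_add_one _
  have hM : 0 < M := Nat.floor_pos.mpr (by linarith)
  have hM1 : (1 : ℝ) ≤ M := by exact_mod_cast hM
  set b := ⌈l ^ 2⌉₊ with hbdef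
  have hble : l ^ 2 ≤ b := Nat.le_ceil _
  have hblt : (b : ℝ) < l ^ 2 + 1 := Nat.ceil_lt_add_one (by positivity)
  have hb : 2 ≤ b := by
    have : (2 : ℝ) ≤ b := by nlinarith
    exact_mod_cast this
  have hlogb : Real.log b ≤ 3 * Real.log l := by
    have h3 : Real.log (l ^ 3) = 3 * Real.log l := by
      rw [Real.log_pow]
      norm_num
    rw [← h3]
    exact Real.log_le_log (by positivity) (by nlinarith [sq_nonneg l])
  have hbd : (b ^ 2) ^ (2 * M) ≤ d := by
    have : (((b ^ 2) ^ (2 * M) : ℕ) : ℝ) ≤ d := by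
      rw [← Real.log_le_log_iff (by positivity) hd0]
      push_cast
      rw [Real.log_pow, Real.log_pow]
      push_cast
      have h1 : (M : ℝ) * Real.log b ≤ q / 16 * (3 * Real.log l) :=
        mul_le_mul hMle hlogb (Real.log_natCast_nonneg b) (by linarith)
      linarith
    exact_mod_cast this
  obtain ⟨D, hne, hfin, hnn, hD⟩ := exists_portfolio_lower_bound (α := 1 * l) hb hM hbd
    (by linarith) (by nlinarith)
  refine ⟨D, hne, hfin, hnn, fun X hXD hX => ?_⟩
  have hcard : (2 : ℝ) ^ M ≤ X.ncard := by
    exact_mod_cast (two_pow_le_centralBinom hM).trans (hD X hXD hX)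
  refine le_trans ?_ hcard
  rw [Real.rpow_def_of_pos hd0, ← hldef, ← Real.rpow_natCast, Real.rpow_def_of_pos two_pos]
  refine Real.exp_le_exp.mpr ?_
  have hrw : l * (1 / 64 / Real.log l) = q / 64 := by
    rw [hq]
    ring
  rw [hrw]
  nlinarith [Real.log_two_gt_d9]
end

section
/- Fix n jobs, d machines, and processing times p_{i,j} > 0 for each machine i ∈ {1,…,d} and job j ∈ {1,…,n}. There exists a schedule S such that for every schedule S' and every k ∈ {1,…,n}, the k-th smallest completion time under S is at most 4 times the k-th smallest completion time under S'. -/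
/-- The `k`-th smallest coordinate is at most `C` iff more than `k` coordinates are at most `C`. -/
lemma sortAsc_le_iff {n : ℕ} (x : Fin n → ℝ) (k : Fin n) (C : ℝ) :
    sortAsc x k ≤ C ↔ (k : ℕ) < (Finset.univ.filter (fun j => x j ≤ C)).card := by
  have h := Tuple.lt_card_le_iff_apply_le_of_monotone (j := k) (a := C)
    (Tuple.monotone_sort x)
  have hcard : (Finset.univ.filter (fun j => (x ∘ Tuple.sort x) j ≤ C)).card =
      (Finset.univ.filter (fun j => x j ≤ C)).card :=
    Finset.card_equiv (Tuple.sort x) (by simp)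
  rw [← hcard]
  exact h.symm

/-- The jobs of `T`, assigned to machines by `b`, give every machine load at most `t`. -/
def LoadsAtMost {n d : ℕ} (p : Fin d → Fin n → ℝ) (t : ℝ) (T : Finset (Fin n))
    (b : Fin n → Fin d) : Prop :=
  ∀ m, ∑ j ∈ T.filter (fun j => b j = m), p m j ≤ t

/-- The jobs that a schedule completes by time `C` have machine loads at most `C`. -/
lemma loadsAtMost_completed {n d : ℕ} {p : Fin d → Fin n → ℝ} (hp : ∀ i j, 0 < p i j)
    (a : Fin n → Fin d) (π : Equiv.Perm (Fin n)) {C : ℝ} (hC : 0 ≤ C) :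
    LoadsAtMost p C (Finset.univ.filter (fun j => completionTime p a π j ≤ C)) a := by
  intro m
  rw [Finset.filter_filter]
  rcases (Finset.univ.filter (fun j => completionTime p a π j ≤ C ∧ a j = m)).eq_empty_or_nonempty
    with h | h
  · simpa [h] using hC
  · obtain ⟨j, hj, hmax⟩ := Finset.exists_max_image _ π h
    simp only [Finset.mem_filter, Finset.mem_univ, true_and] at hj hmax
    obtain ⟨hjC, rfl⟩ := hj
    refine le_trans ?_ hjC
    refine Finset.sum_le_sum_of_subset_of_nonneg (fun i hi => ?_) (fun i _ _ => (hp _ _).le)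
    simp only [Finset.mem_filter, Finset.mem_univ, true_and] at hi ⊢
    exact ⟨hi.2, hmax i hi⟩

/-- There is a largest set of jobs that can be scheduled with loads at most `t`. -/
lemma exists_maximum_loadsAtMost {n d : ℕ} (hd : 1 ≤ d) (p : Fin d → Fin n → ℝ) {t : ℝ}
    (ht : 0 ≤ t) :
    ∃ (T : Finset (Fin n)) (b : Fin n → Fin d), LoadsAtMost p t T b ∧
      ∀ T' b', LoadsAtMost p t T' b' → T'.card ≤ T.card := by
  obtain ⟨⟨T, b⟩, h, hmax⟩ := Set.exists_max_image
    {q : Finset (Fin n) × (Fin n → Fin d) | LoadsAtMost p t q.1 q.2} (fun q => q.1.card)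
    (Set.toFinite _) ⟨(∅, fun _ => ⟨0, hd⟩), fun m => by simpa using ht⟩
  exact ⟨T, b, h, fun T' b' h' => hmax (T', b') h'⟩

/-- For all large enough times, all jobs can be scheduled. -/
lemma exists_pow_loadsAtMost_univ {n d : ℕ} {p : Fin d → Fin n → ℝ} (hp : ∀ i j, 0 < p i j)
    (b : Fin n → Fin d) {c : ℝ} (hc : 0 < c) :
    ∃ i : ℕ, LoadsAtMost p (c * 2 ^ i) Finset.univ b := by
  obtain ⟨i, hi⟩ := pow_unbounded_of_one_lt ((∑ m, ∑ j, p m j) / c) (one_lt_two (α := ℝ))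
  refine ⟨i, fun m => ?_⟩
  rw [div_lt_iff₀' hc] at hi
  refine le_trans ?_ hi.le
  calc ∑ j ∈ Finset.univ.filter (fun j => b j = m), p m j
      ≤ ∑ j, p m j := Finset.sum_le_sum_of_subset_of_nonneg (Finset.filter_subset _ _)
        (fun j _ _ => (hp m j).le)
    _ ≤ ∑ m, ∑ j, p m j := Finset.single_le_sum (f := fun m => ∑ j, p m j)
        (fun m _ => Finset.sum_nonneg fun j _ => (hp m j).le) (Finset.mem_univ m)

/-- If each stage `i` has machine loads at most `c * 2 ^ i` and jobs are processed in the order of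
their stages, then the jobs of stage `s j` are completed by time `c * 2 ^ (s j + 1)`. -/
lemma completionTime_le_of_stages {n d : ℕ} {p : Fin d → Fin n → ℝ} (hp : ∀ i j, 0 < p i j)
    {c : ℝ} (hc : 0 < c) (s : Fin n → ℕ) (a : Fin n → Fin d) (π : Equiv.Perm (Fin n))
    (hπ : ∀ j j', π j' ≤ π j → s j' ≤ s j)
    (hs : ∀ i, LoadsAtMost p (c * 2 ^ i) (Finset.univ.filter (fun j => s j = i)) a) (j : Fin n) :
    completionTime p a π j ≤ c * 2 ^ (s j + 1) := by
  unfold completionTime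
  rw [← Finset.sum_fiberwise_of_maps_to (g := s) (t := Finset.range (s j + 1))
    (fun j' hj' => Finset.mem_range_succ_iff.2 (hπ j j' (Finset.mem_filter.1 hj').2.2))]
  calc _ ≤ ∑ i ∈ Finset.range (s j + 1), c * 2 ^ i := by
        refine Finset.sum_le_sum fun i _ => le_trans ?_ (hs i (a j))
        refine Finset.sum_le_sum_of_subset_of_nonneg (fun j' hj' => ?_) (fun j' _ _ => (hp _ _).le)
        simp only [Finset.mem_filter, Finset.mem_univ, true_and] at hj' ⊢
        exact ⟨hj'.2, hj'.1.1⟩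
    _ = c * (2 ^ (s j + 1) - 1) := by
        rw [← Finset.mul_sum, geom_sum_eq (by norm_num)]
        norm_num
    _ ≤ c * 2 ^ (s j + 1) := by nlinarith

/-- Theorem: existence of a simultaneous 4-approximation for Completion-Times. -/
theorem stmt5 (n d : ℕ) (hd : 1 ≤ d) (p : Fin d → Fin n → ℝ) (hp : ∀ i j, 0 < p i j) :
    ∃ (a : Fin n → Fin d) (π : Equiv.Perm (Fin n)),
      ∀ (a' : Fin n → Fin d) (π' : Equiv.Perm (Fin n)) (k : Fin n),
        sortAsc (completionTime p a π) k ≤ 4 * sortAsc (completionTime p a' π') k := by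
  rcases Nat.eq_zero_or_pos n with rfl | hn
  · exact ⟨Fin.elim0, 1, fun _ _ k => k.elim0⟩
  obtain ⟨c, hc, hcp⟩ : ∃ c : ℝ, 0 < c ∧ ∀ i j, c ≤ p i j := by
    have : Nonempty (Fin d × Fin n) := ⟨(⟨0, hd⟩, ⟨0, hn⟩)⟩
    obtain ⟨q, hq⟩ := Finite.exists_min (fun q : Fin d × Fin n => p q.1 q.2)
    exact ⟨p q.1 q.2, hp _ _, fun i j => hq (i, j)⟩
  have hpow (i : ℕ) : 0 ≤ c * 2 ^ i := by positivity
  choose T b hTb hmax using fun i => exists_maximum_loadsAtMost hd p (hpow i)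
  have hex (j : Fin n) : ∃ i, j ∈ T i := by
    obtain ⟨i, hi⟩ := exists_pow_loadsAtMost_univ hp (fun _ => ⟨0, hd⟩) hc
    refine ⟨i, ?_⟩
    rw [Finset.eq_univ_of_card (T i)
      (le_antisymm (Finset.card_le_univ _) (hmax i _ _ hi))]
    exact Finset.mem_univ j
  set s : Fin n → ℕ := fun j => Nat.find (hex j)
  set a : Fin n → Fin d := fun j => b (s j) j
  set π : Equiv.Perm (Fin n) := (Tuple.sort s)⁻¹ with hπ
  have hstage (j : Fin n) : completionTime p a π j ≤ c * 2 ^ (s j + 1) := by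
    refine completionTime_le_of_stages hp hc s a π (fun j j' h => ?_) (fun i m => ?_) j
    · simpa [hπ] using Tuple.monotone_sort s h
    · refine le_trans (Finset.sum_le_sum_of_subset_of_nonneg (fun j hj => ?_)
        (fun j _ _ => (hp _ _).le)) (hTb i m)
      simp only [Finset.mem_filter, Finset.mem_univ, true_and] at hj ⊢
      obtain ⟨rfl, hm⟩ := hj
      exact ⟨Nat.find_spec (hex j), hm⟩
  refine ⟨a, π, fun a' π' k => ?_⟩
  set C := sortAsc (completionTime p a' π') k
  have hcC : c ≤ C := by
    set j := Tuple.sort (completionTime p a' π') k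
    refine (hcp (a' j) j).trans ?_
    exact Finset.single_le_sum (f := fun j' => p (a' j) j') (fun j' _ => (hp _ _).le)
      (Finset.mem_filter.2 ⟨Finset.mem_univ j, rfl, le_rfl⟩)
  obtain ⟨i, hi, hi'⟩ := exists_nat_pow_near ((one_le_div hc).2 hcC) (one_lt_two (α := ℝ))
  rw [le_div_iff₀' hc] at hi
  rw [div_lt_iff₀' hc] at hi'
  have hk := (sortAsc_le_iff (completionTime p a' π') k C).1 le_rfl
  have hload := loadsAtMost_completed hp a' π' (hc.le.trans hcC)
  rw [sortAsc_le_iff]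
  refine (hk.trans_le (hmax (i + 1) _ a' fun m => (hload m).trans hi'.le)).trans_le
    (Finset.card_le_card fun j hj => ?_)
  rw [Finset.mem_filter]
  refine ⟨Finset.mem_univ j, (hstage j).trans ?_⟩
  have hsj : s j ≤ i + 1 := Nat.find_min' (hex j) hj
  calc c * 2 ^ (s j + 1) ≤ c * 2 ^ (i + 2) :=
        mul_le_mul_of_nonneg_left (pow_le_pow_right₀ one_le_two (by omega)) hc.le
    _ = 4 * (c * 2 ^ i) := by ring
    _ ≤ 4 * C := by linarith
end

section
/- Let (V, dist) be a finite metric space with |V| = n ≥ 1 and let v_0 ∈ V. There exists a tour τ starting at v_0 such that for every tour τ' starting at v_0 and every k ∈ {1,…,n}, the k-th smallest visit time under τ is at most (3 + 2√2) times the k-th smallest visit time under τ'. -/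
/-- The length of the walk that starts at `x` and then visits the entries of a list in order. -/
noncomputable def walkLength {V : Type*} [MetricSpace V] : V → List V → ℝ
  | _, [] => 0
  | x, y :: t => dist x y + walkLength y t

theorem walkLength_le_dist_add {V : Type*} [MetricSpace V] (x y : V) (t : List V) :
    walkLength x t ≤ dist x y + walkLength y t := by
  cases t with
  | nil => simp [walkLength]
  | cons z t =>
    simp only [walkLength]
    linarith [dist_triangle x y z]

theorem walkLength_le_of_sublist {V : Type*} [MetricSpace V] {s t : List V}
    (h : s.Sublist t) (x : V) : walkLength x s ≤ walkLength x t := by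
  induction h generalizing x with
  | slnil => exact le_rfl
  | cons y _ ih => exact (ih x).trans (walkLength_le_dist_add x y _)
  | cons_cons y _ ih => exact add_le_add_right (ih y) _

theorem dist_le_walkLength {V : Type*} [MetricSpace V] {x y : V} {t : List V}
    (h : y ∈ t) : dist x y ≤ walkLength x t := by
  simpa [walkLength] using walkLength_le_of_sublist (List.singleton_sublist.2 h) x

theorem walkLength_append_le {V : Type*} [MetricSpace V] {v : V} {R : ℝ} (s t : List V) (x : V)
    (h : ∀ y ∈ x :: s, dist v y ≤ R) :
    walkLength x (s ++ t) ≤ walkLength x s + R + walkLength v t := by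
  induction s generalizing x with
  | nil =>
    have h1 := walkLength_le_dist_add x v t
    have h2 := h x (by simp)
    rw [dist_comm] at h2
    simp only [List.nil_append, walkLength]
    linarith
  | cons y s ih =>
    have := ih y fun z hz => h z (List.mem_cons_of_mem _ hz)
    simp only [List.cons_append, walkLength]
    linarith

theorem walkLength_map_range {V : Type*} [MetricSpace V] (τ : ℕ → V) (k : ℕ) :
    walkLength (τ 0) ((List.range k).map fun j => τ (j + 1)) =
      ∑ j ∈ Finset.range k, dist (τ j) (τ (j + 1)) := by
  induction k generalizing τ with
  | zero => simp [walkLength]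
  | succ k ih =>
    have := ih fun j => τ (j + 1)
    rw [Finset.sum_range_succ', List.range_succ_eq_map, List.map_cons, List.map_map, walkLength,
      add_comm]
    exact congrArg (· + dist (τ 0) (τ 1)) this

theorem monotone_tourVisitTimes {V : Type*} [MetricSpace V] (n : ℕ) (τ : ℕ → V) :
    Monotone (tourVisitTimes n τ) := fun _ _ h =>
  Finset.sum_le_sum_of_subset_of_nonneg (Finset.range_mono h) fun _ _ _ => dist_nonneg

theorem sortAsc_eq_self {n : ℕ} {x : Fin n → ℝ} (h : Monotone x) : sortAsc x = x := by
  funext k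
  simp [sortAsc, Tuple.sort_eq_refl_iff_monotone.2 h]

/-- A duplicate-free list of all vertices with head `v` yields a tour whose visit times are the
lengths of the prefixes of the list. -/
theorem exists_isTour_of_nodup {V : Type*} [MetricSpace V] [Fintype V] {v : V} {t : List V}
    (hnd : (v :: t).Nodup) (hlen : (v :: t).length = Fintype.card V) :
    ∃ τ : ℕ → V, IsTour (Fintype.card V) v τ ∧ ∀ k : Fin (Fintype.card V),
      tourVisitTimes (Fintype.card V) τ k = walkLength v (t.take k) := by
  classical
  refine ⟨fun j => (v :: t).getD j v, ⟨by simp, fun _ _ => Set.mem_univ _, ?_, ?_⟩, ?_⟩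
  · intro i hi j hj hij
    simp only [Set.mem_Iio, ← hlen] at hi hj
    simp only [List.getD_eq_getElem _ _ hi, List.getD_eq_getElem _ _ hj] at hij
    exact (hnd.getElem_inj_iff).1 hij
  · intro x _
    have hu : (v :: t).toFinset = Finset.univ :=
      Finset.card_eq_iff_eq_univ _ |>.1 (by rw [List.toFinset_card_of_nodup hnd, hlen])
    have hx : x ∈ v :: t := by rw [← List.mem_toFinset, hu]; simp
    obtain ⟨i, hi, rfl⟩ := List.getElem_of_mem hx
    exact ⟨i, by simpa [← hlen] using hi, List.getD_eq_getElem _ _ hi⟩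
  · intro k
    have hk : (k : ℕ) ≤ t.length := by
      have := k.2
      simp only [← hlen, List.length_cons] at this
      omega
    rw [tourVisitTimes, ← walkLength_map_range]
    congr 1
    apply List.ext_getElem
    · simp [hk]
    · intro i h1 h2
      have : i < t.length := by simp at h2; omega
      simp [this]

theorem exists_pos_forall_lt_dist (V : Type*) [MetricSpace V] [Fintype V] :
    ∃ L : ℝ, 0 < L ∧ ∀ x y : V, x ≠ y → L < dist x y := by
  classical
  have : ∀ s : Finset (V × V), ∃ L : ℝ, 0 < L ∧ ∀ p ∈ s, p.1 ≠ p.2 → L < dist p.1 p.2 := by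
    intro s
    induction s using Finset.induction_on with
    | empty => exact ⟨1, one_pos, by simp⟩
    | insert p s _ ih =>
      obtain ⟨L, hL, h⟩ := ih
      by_cases hp : p.1 = p.2
      · refine ⟨L, hL, fun q hq hne => ?_⟩
        rcases Finset.mem_insert.1 hq with rfl | hq
        · exact absurd hp hne
        · exact h q hq hne
      · have hd := dist_pos.2 hp
        refine ⟨min L (dist p.1 p.2 / 2), by positivity, fun q hq hne => ?_⟩
        rcases Finset.mem_insert.1 hq with rfl | hq
        · exact (min_le_right _ _).trans_lt (by linarith)
        · exact (min_le_left _ _).trans_lt (h q hq hne)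
  obtain ⟨L, hL, h⟩ := this Finset.univ
  exact ⟨L, hL, fun x y hxy => h (x, y) (Finset.mem_univ _) hxy⟩

/-- Combining, for the budgets `L * a ^ j` with `j ≤ i`, tour prefixes within budget that visit as
many vertices as possible. -/
theorem exists_prefix_within_budget {V : Type*} [MetricSpace V] [Fintype V] (v : V) {L a : ℝ}
    (hL : 0 < L) (hdist : ∀ x y : V, x ≠ y → L < dist x y) (ha : 1 ≤ a) (ha2 : a ^ 2 = 2 * a + 1)
    (τ₀ : ℕ → V) (hτ₀ : IsTour (Fintype.card V) v τ₀) (i : ℕ) :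
    ∃ t : List V, (v :: t).Nodup ∧ (∀ x ∈ v :: t, dist v x ≤ L * a ^ i) ∧
      walkLength v t ≤ L * a ^ (i + 1) ∧
      (∀ τ : ℕ → V, IsTour (Fintype.card V) v τ → ∀ k : Fin (Fintype.card V),
        tourVisitTimes _ τ k ≤ L * a ^ i → k ≤ t.length) ∧
      ∀ τ : ℕ → V, IsTour (Fintype.card V) v τ → ∀ k : Fin (Fintype.card V), k ≤ t.length →
        walkLength v (t.take k) ≤ a ^ 2 * tourVisitTimes _ τ k := by
  classical
  have hpos : 0 < Fintype.card V := Fintype.card_pos_iff.2 ⟨v⟩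
  induction i with
  | zero =>
    refine ⟨[], by simp, by simp [hL.le], ?_, ?_, ?_⟩
    · simp only [walkLength]; positivity
    · intro τ hτ k hk
      by_contra! hlt
      simp only [List.length_nil] at hlt
      have h1 : τ 0 ≠ τ 1 := fun h =>
        absurd (hτ.2.injOn (Set.mem_Iio.2 hpos)
          (Set.mem_Iio.2 (lt_of_le_of_lt hlt k.2)) h) (by simp)
      have h2 : dist (τ 0) (τ 1) ≤ tourVisitTimes _ τ k :=
        Finset.single_le_sum (f := fun j => dist (τ j) (τ (j + 1)))
          (fun _ _ => dist_nonneg) (Finset.mem_range.2 hlt)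
      have := hdist _ _ h1
      simp at hk
      linarith
    · intro τ _ k _
      simp only [List.take_nil, walkLength]
      exact mul_nonneg (sq_nonneg _) (Finset.sum_nonneg fun _ _ => dist_nonneg)
  | succ i ih =>
    obtain ⟨t, hnd, hball, hcost, hcover, happrox⟩ := ih
    have hai : 0 < L * a ^ i := by positivity
    have hmono : L * a ^ i ≤ L * a ^ (i + 1) := by
      rw [pow_succ, ← mul_assoc]; exact le_mul_of_one_le_right hai.le ha
    obtain ⟨m, ⟨τ, hτ, hm⟩, hmax⟩ := (Set.toFinite {k : Fin (Fintype.card V) |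
        ∃ τ, IsTour (Fintype.card V) v τ ∧ tourVisitTimes _ τ k ≤ L * a ^ (i + 1)}).exists_maximal
      ⟨⟨0, hpos⟩, τ₀, hτ₀, by
        simp only [tourVisitTimes, Finset.range_zero, Finset.sum_empty]; positivity⟩
    set p : List V := (List.range m).map fun j => τ (j + 1) with hp
    have hpl : walkLength v p ≤ L * a ^ (i + 1) := by
      rw [← hτ.1, walkLength_map_range]; exact hm
    set q : List V := p.filter fun x => x ∉ v :: t with hq
    have hql : walkLength v q ≤ L * a ^ (i + 1) :=
      (walkLength_le_of_sublist List.filter_sublist v).trans hpl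
    have hpn : (v :: p).Nodup := by
      have : v :: p = (List.range (m + 1)).map τ := by
        rw [List.range_succ_eq_map, List.map_cons, List.map_map, hτ.1]; rfl
      rw [this]
      refine List.Nodup.map_on ?_ List.nodup_range
      intro x hx y hy h
      simp only [List.mem_range] at hx hy
      exact hτ.2.injOn (Set.mem_Iio.2 (by omega)) (Set.mem_Iio.2 (by omega)) h
    have hnd' : (v :: (t ++ q)).Nodup := by
      rw [← List.cons_append, List.nodup_append']
      refine ⟨hnd, (List.nodup_cons.1 hpn).2.filter _, fun x hx hxq => ?_⟩
      simpa [hx] using (List.mem_filter.1 hxq).2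
    have hlen : (m : ℕ) ≤ (t ++ q).length := by
      have hsub : v :: p ⊆ v :: (t ++ q) := by
        intro x hx
        by_cases hxt : x ∈ v :: t
        · exact List.mem_append_left q hxt
        · rcases List.mem_cons.1 hx with rfl | hxp
          · simp
          · exact List.mem_append_right (v :: t) (List.mem_filter.2 ⟨hxp, by simpa using hxt⟩)
      have := (hpn.subperm hsub).length_le
      simpa [hp] using this
    have hcost' : walkLength v (t ++ q) ≤ L * a ^ (i + 1 + 1) := by
      have h := walkLength_append_le t q v hball
      have : L * a ^ (i + 1 + 1) = L * a ^ i + 2 * (L * a ^ (i + 1)) := by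
        linear_combination L * a ^ i * ha2
      linarith
    refine ⟨t ++ q, hnd', ?_, hcost', ?_, ?_⟩
    · intro x hx
      rw [← List.cons_append] at hx
      rcases List.mem_append.1 hx with hx | hx
      · exact (hball x hx).trans hmono
      · exact (dist_le_walkLength hx).trans hql
    · intro σ hσ k hk
      refine le_trans ?_ hlen
      rcases le_total k m with h | h
      · exact h
      · exact hmax ⟨σ, hσ, hk⟩ h
    · intro σ hσ k hk
      by_cases hkt : (k : ℕ) ≤ t.length
      · rw [List.take_append_of_le_length hkt]
        exact happrox σ hσ k hkt
      · have h1 : L * a ^ i < tourVisitTimes _ σ k := by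
          by_contra! h
          exact hkt (hcover σ hσ k h)
        calc walkLength v ((t ++ q).take k) ≤ walkLength v (t ++ q) :=
              walkLength_le_of_sublist (List.take_sublist _ _) v
          _ ≤ L * a ^ (i + 1 + 1) := hcost'
          _ = a ^ 2 * (L * a ^ i) := by ring
          _ ≤ _ := by gcongr

/-- Theorem: existence of a simultaneous (3 + 2√2)-approximation for Ordered-TSP. -/
theorem stmt6 {V : Type*} [MetricSpace V] [Fintype V] (n : ℕ) (hn : 1 ≤ n)
    (hcard : Fintype.card V = n) (v₀ : V) :
    ∃ τ : ℕ → V, IsTour n v₀ τ ∧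
      ∀ τ' : ℕ → V, IsTour n v₀ τ' →
        ∀ k : Fin n,
          sortAsc (tourVisitTimes n τ) k ≤
            (3 + 2 * Real.sqrt 2) * sortAsc (tourVisitTimes n τ') k := by
  classical
  subst hcard
  simp only [sortAsc_eq_self (monotone_tourVisitTimes _ _)]
  obtain ⟨L, hL, hdist⟩ := exists_pos_forall_lt_dist V
  obtain ⟨τ₀, hτ₀, -⟩ := exists_isTour_of_nodup (v := v₀)
    (t := (Finset.univ.erase v₀).toList) (by simp [Finset.nodup_toList])
    (by
        simp only [List.length_cons, Finset.length_toList,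
          Finset.card_erase_of_mem (Finset.mem_univ v₀), Finset.card_univ]
        omega)
  have hs : Real.sqrt 2 ^ 2 = 2 := Real.sq_sqrt (by norm_num)
  have hs0 : 0 < Real.sqrt 2 := by positivity
  have ha2 : (1 + Real.sqrt 2) ^ 2 = 3 + 2 * Real.sqrt 2 := by linear_combination hs
  have hlast : Fintype.card V - 1 < Fintype.card V := by omega
  obtain ⟨i, hi⟩ := pow_unbounded_of_one_lt
    (tourVisitTimes _ τ₀ ⟨Fintype.card V - 1, hlast⟩ / L) (y := 1 + Real.sqrt 2) (by linarith)
  obtain ⟨t, hnd, -, -, hcover, happrox⟩ := exists_prefix_within_budget v₀ hL hdist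
    (a := 1 + Real.sqrt 2) (by linarith) (by linear_combination hs) τ₀ hτ₀ i
  have hge : Fintype.card V - 1 ≤ t.length :=
    hcover τ₀ hτ₀ ⟨_, hlast⟩ (by rw [div_lt_iff₀ hL] at hi; linarith)
  have hlen : (v₀ :: t).length = Fintype.card V := by
    refine le_antisymm hnd.length_le_card ?_
    simp only [List.length_cons]
    omega
  obtain ⟨τ, hτ, hvisit⟩ := exists_isTour_of_nodup hnd hlen
  refine ⟨τ, hτ, fun τ' hτ' k => ?_⟩
  rw [hvisit, ← ha2]
  exact happrox τ' hτ' k (by omega)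
end
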